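/- arXiv:1305.3788 — 16 statements merged into one kernel-verified Lean document; each statement's English description precedes it below -/
import Mathlib

section
/- On the set V = {(x,y) ∈ ℝ³×ℝ³ : ⟨x,x⟩_L + 1 = 0 and ⟨x,y⟩_L = 0}, the Dirac–Poisson brackets of the coordinate functions are: {x_i,x_j}* = 0 for all i,j; {x₁,y₁}* = 1+x₁², {x₁,y₂}* = x₁x₂, {x₁,y₃}* = x₁x₃, {x₂,y₁}* = x₁x₂, {x₂,y₂}* = 1+x₂², {x₂,y₃}* = x₂x₃, {x₃,y₁}* = x₁x₃, {x₃,y₂}* = x₂x₃, {x₃,y₃}* = −1+x₃²; {y₁,y₂}* = x₁y₂−x₂y₁, {y₁,y₃}* = x₁y₃−x₃y₁, {y₂,y₃}* = x₂y₃−x₃y₂. Moreover c₁(x,y) = ⟨x,x⟩_L+1 and c₂(x,y) = ⟨x,y⟩_L are Casimirs: {c₁,f}* = 0 and {c₂,f}* = 0 on V for every differentiable scalar field f. -/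
noncomputable section

/-- Points of `ℝ³`. -/
abbrev V3 : Type := Fin 3 → ℝ

/-- Phase space `ℝ³ × ℝ³` with coordinates `(x, y)`. -/
abbrev Phase : Type := V3 × V3

/-- The Lorentz pseudo inner product `⟨u,v⟩_L = u₁v₁ + u₂v₂ − u₃v₃`. -/
def Lprod (u v : V3) : ℝ := u 0 * v 0 + u 1 * v 1 - u 2 * v 2

/-- Sign pattern of the Lorentz gradient. -/
def sgn3 (i : Fin 3) : ℝ := if i = 2 then -1 else 1

/-- The Lorentz gradient `∇_L f = (∂₁f, ∂₂f, −∂₃f)` of a scalar field on `ℝ³`. -/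
def Lgrad (U : V3 → ℝ) (x : V3) : V3 :=
  fun i => sgn3 i * fderiv ℝ U x (Pi.single i 1 : V3)

/-- The Lorentz gradient with respect to the `x`-variables. -/
def Lgradx (f : Phase → ℝ) (z : Phase) : V3 :=
  fun i => sgn3 i * fderiv ℝ f z ((Pi.single i 1 : V3), (0 : V3))

/-- The Lorentz gradient with respect to the `y`-variables. -/
def Lgrady (f : Phase → ℝ) (z : Phase) : V3 :=
  fun i => sgn3 i * fderiv ℝ f z ((0 : V3), (Pi.single i 1 : V3))

/-- The Poisson bracket `{f,g} = ⟨∇_L^x f, ∇_L^y g⟩_L − ⟨∇_L^x g, ∇_L^y f⟩_L`. -/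
def pb (f g : Phase → ℝ) (z : Phase) : ℝ :=
  Lprod (Lgradx f z) (Lgrady g z) - Lprod (Lgradx g z) (Lgrady f z)

/-- The first constraint `c₁(x,y) = ⟨x,x⟩_L + 1`. -/
def c1 (z : Phase) : ℝ := Lprod z.1 z.1 + 1

/-- The second constraint `c₂(x,y) = ⟨x,y⟩_L`. -/
def c2 (z : Phase) : ℝ := Lprod z.1 z.2

/-- The Dirac–Poisson bracket
`{f,g}* = {f,g} + (1/(2⟨x,x⟩_L))({f,c₂}{g,c₁} − {f,c₁}{g,c₂})`. -/
def dpb (f g : Phase → ℝ) (z : Phase) : ℝ :=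
  pb f g z + (1 / (2 * Lprod z.1 z.1)) * (pb f c2 z * pb g c1 z - pb f c1 z * pb g c2 z)

/-- The coordinate function `x_i`. -/
def Xc (i : Fin 3) : Phase → ℝ := fun z => z.1 i

/-- The coordinate function `y_i`. -/
def Yc (i : Fin 3) : Phase → ℝ := fun z => z.2 i

lemma hasFDerivAt_Xc (i : Fin 3) (z : Phase) :
    HasFDerivAt (Xc i)
      ((ContinuousLinearMap.proj i : V3 →L[ℝ] ℝ).comp (ContinuousLinearMap.fst ℝ V3 V3)) z :=
  ContinuousLinearMap.hasFDerivAt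
    ((ContinuousLinearMap.proj i : V3 →L[ℝ] ℝ).comp (ContinuousLinearMap.fst ℝ V3 V3))

lemma hasFDerivAt_Yc (i : Fin 3) (z : Phase) :
    HasFDerivAt (Yc i)
      ((ContinuousLinearMap.proj i : V3 →L[ℝ] ℝ).comp (ContinuousLinearMap.snd ℝ V3 V3)) z :=
  ContinuousLinearMap.hasFDerivAt
    ((ContinuousLinearMap.proj i : V3 →L[ℝ] ℝ).comp (ContinuousLinearMap.snd ℝ V3 V3))

lemma fderiv_c1_apply (z w : Phase) : fderiv ℝ c1 z w = 2 * Lprod z.1 w.1 := by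
  have h (i : Fin 3) := (hasFDerivAt_Xc i z).mul (hasFDerivAt_Xc i z)
  have hc : HasFDerivAt c1 _ z := (((h 0).add (h 1)).sub (h 2)).add_const 1
  rw [hc.fderiv]
  simp [Xc, Lprod]
  ring

lemma fderiv_c2_apply (z w : Phase) :
    fderiv ℝ c2 z w = Lprod z.1 w.2 + Lprod w.1 z.2 := by
  have h (i : Fin 3) := (hasFDerivAt_Xc i z).mul (hasFDerivAt_Yc i z)
  have hc : HasFDerivAt c2 _ z := ((h 0).add (h 1)).sub (h 2)
  rw [hc.fderiv]
  simp [Xc, Yc, Lprod]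
  ring

lemma Lgradx_Xc (i : Fin 3) (z : Phase) : Lgradx (Xc i) z = Pi.single i (sgn3 i) := by
  ext j
  simp [Lgradx, (hasFDerivAt_Xc i z).fderiv, Pi.single_apply, eq_comm]
  grind

lemma Lgrady_Xc (i : Fin 3) (z : Phase) : Lgrady (Xc i) z = 0 := by
  ext j
  simp [Lgrady, (hasFDerivAt_Xc i z).fderiv]

lemma Lgradx_Yc (i : Fin 3) (z : Phase) : Lgradx (Yc i) z = 0 := by
  ext j
  simp [Lgradx, (hasFDerivAt_Yc i z).fderiv]

lemma Lgrady_Yc (i : Fin 3) (z : Phase) : Lgrady (Yc i) z = Pi.single i (sgn3 i) := by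
  ext j
  simp [Lgrady, (hasFDerivAt_Yc i z).fderiv, Pi.single_apply, eq_comm]
  grind

lemma Lgradx_c1 (z : Phase) : Lgradx c1 z = (2 : ℝ) • z.1 := by
  ext j
  fin_cases j <;> simp [Lgradx, fderiv_c1_apply, Lprod, sgn3]

lemma Lgrady_c1 (z : Phase) : Lgrady c1 z = 0 := by
  ext j
  simp [Lgrady, fderiv_c1_apply, Lprod]

lemma Lgradx_c2 (z : Phase) : Lgradx c2 z = z.2 := by
  ext j
  fin_cases j <;> simp [Lgradx, fderiv_c2_apply, Lprod, sgn3]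

lemma Lgrady_c2 (z : Phase) : Lgrady c2 z = z.1 := by
  ext j
  fin_cases j <;> simp [Lgrady, fderiv_c2_apply, Lprod, sgn3]

lemma pb_antisymm (f g : Phase → ℝ) (z : Phase) : pb f g z = -pb g f z := by
  simp [pb]

lemma pb_self (f : Phase → ℝ) (z : Phase) : pb f f z = 0 := by
  simp [pb]

lemma pb_c1_c2 (z : Phase) : pb c1 c2 z = 2 * Lprod z.1 z.1 := by
  simp [pb, Lgradx_c1, Lgrady_c1, Lgradx_c2, Lgrady_c2, Lprod]
  ring

lemma dpb_c1 (f : Phase → ℝ) {z : Phase} (hz : Lprod z.1 z.1 ≠ 0) : dpb c1 f z = 0 := by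
  rw [dpb, pb_self, pb_c1_c2, pb_antisymm f c1]
  field_simp
  ring

lemma dpb_c2 (f : Phase → ℝ) {z : Phase} (hz : Lprod z.1 z.1 ≠ 0) : dpb c2 f z = 0 := by
  rw [dpb, pb_self, pb_antisymm c2 c1, pb_c1_c2, pb_antisymm f c2]
  field_simp
  ring

lemma pb_Xc_Xc (i j : Fin 3) (z : Phase) : pb (Xc i) (Xc j) z = 0 := by
  simp [pb, Lgrady_Xc, Lprod]

lemma pb_Yc_Yc (i j : Fin 3) (z : Phase) : pb (Yc i) (Yc j) z = 0 := by
  simp [pb, Lgradx_Yc, Lprod]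

lemma pb_Xc_Yc (i j : Fin 3) (z : Phase) :
    pb (Xc i) (Yc j) z = if i = j then sgn3 i else 0 := by
  fin_cases i <;> fin_cases j <;>
    simp [pb, Lgradx_Xc, Lgrady_Xc, Lgradx_Yc, Lgrady_Yc, Lprod, sgn3]

lemma pb_Xc_c1 (i : Fin 3) (z : Phase) : pb (Xc i) c1 z = 0 := by
  simp [pb, Lgrady_Xc, Lgrady_c1, Lprod]

lemma pb_Xc_c2 (i : Fin 3) (z : Phase) : pb (Xc i) c2 z = z.1 i := by
  fin_cases i <;> simp [pb, Lgradx_Xc, Lgrady_Xc, Lgradx_c2, Lgrady_c2, Lprod, sgn3]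

lemma pb_Yc_c1 (i : Fin 3) (z : Phase) : pb (Yc i) c1 z = -2 * z.1 i := by
  fin_cases i <;> simp [pb, Lgradx_Yc, Lgrady_Yc, Lgradx_c1, Lgrady_c1, Lprod, sgn3]

lemma pb_Yc_c2 (i : Fin 3) (z : Phase) : pb (Yc i) c2 z = -z.2 i := by
  fin_cases i <;> simp [pb, Lgradx_Yc, Lgrady_Yc, Lgradx_c2, Lgrady_c2, Lprod, sgn3]

lemma dpb_Xc_Xc (i j : Fin 3) (z : Phase) : dpb (Xc i) (Xc j) z = 0 := by
  simp [dpb, pb_Xc_Xc, pb_Xc_c1]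

lemma dpb_Xc_Yc (i j : Fin 3) {z : Phase} (hz : Lprod z.1 z.1 = -1) :
    dpb (Xc i) (Yc j) z = (if i = j then sgn3 i else 0) + z.1 i * z.1 j := by
  rw [dpb, hz, pb_Xc_Yc, pb_Xc_c1, pb_Xc_c2, pb_Yc_c1]
  ring

lemma dpb_Yc_Yc (i j : Fin 3) {z : Phase} (hz : Lprod z.1 z.1 = -1) :
    dpb (Yc i) (Yc j) z = z.1 i * z.2 j - z.1 j * z.2 i := by
  rw [dpb, hz, pb_Yc_Yc]
  simp only [pb_Yc_c1, pb_Yc_c2]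
  ring

/-- the Dirac–Poisson brackets of the coordinate functions on
`V = {(x,y) : ⟨x,x⟩_L + 1 = 0, ⟨x,y⟩_L = 0}`, and the Casimir property of `c₁`, `c₂`. -/
theorem dirac_poisson_brackets (z : Phase)
    (h1 : Lprod z.1 z.1 + 1 = 0) (h2 : Lprod z.1 z.2 = 0) :
    (∀ i j : Fin 3, dpb (Xc i) (Xc j) z = 0) ∧
    dpb (Xc 0) (Yc 0) z = 1 + (z.1 0)^2 ∧
    dpb (Xc 0) (Yc 1) z = z.1 0 * z.1 1 ∧
    dpb (Xc 0) (Yc 2) z = z.1 0 * z.1 2 ∧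
    dpb (Xc 1) (Yc 0) z = z.1 0 * z.1 1 ∧
    dpb (Xc 1) (Yc 1) z = 1 + (z.1 1)^2 ∧
    dpb (Xc 1) (Yc 2) z = z.1 1 * z.1 2 ∧
    dpb (Xc 2) (Yc 0) z = z.1 0 * z.1 2 ∧
    dpb (Xc 2) (Yc 1) z = z.1 1 * z.1 2 ∧
    dpb (Xc 2) (Yc 2) z = -1 + (z.1 2)^2 ∧
    dpb (Yc 0) (Yc 1) z = z.1 0 * z.2 1 - z.1 1 * z.2 0 ∧
    dpb (Yc 0) (Yc 2) z = z.1 0 * z.2 2 - z.1 2 * z.2 0 ∧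
    dpb (Yc 1) (Yc 2) z = z.1 1 * z.2 2 - z.1 2 * z.2 1 ∧
    (∀ f : Phase → ℝ, Differentiable ℝ f → dpb c1 f z = 0 ∧ dpb c2 f z = 0) := by
  have hz : Lprod z.1 z.1 = -1 := by linarith
  have hz0 : Lprod z.1 z.1 ≠ 0 := by simp [hz]
  refine ⟨fun i j => dpb_Xc_Xc i j z, ?_, ?_, ?_, ?_, ?_, ?_, ?_, ?_, ?_, dpb_Yc_Yc 0 1 hz,
    dpb_Yc_Yc 0 2 hz, dpb_Yc_Yc 1 2 hz, fun f _ => ⟨dpb_c1 f hz0, dpb_c2 f hz0⟩⟩ <;>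
  simp [dpb_Xc_Yc _ _ hz, sgn3, sq, mul_comm]
end
end

section
/- Let A be a linear map on ℝ³ with ⟨Au,Av⟩_L = ⟨u,v⟩_L for all u,v ∈ ℝ³, and let Ã(x,y) = (Ax,Ay). Then for all differentiable scalar fields f,g on ℝ³×ℝ³ one has {f∘Ã, g∘Ã}* = {f,g}*∘Ã at every point (x,y) with ⟨x,x⟩_L ≠ 0. In particular, if f and g are invariant under Ã then so is {f,g}*. -/
noncomputable section

theorem Lprod_eq_of_forall {u v : V3} (h : ∀ w, Lprod u w = Lprod v w) : u = v := by
  ext i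
  have := h (Pi.single i 1)
  fin_cases i <;> simpa [Lprod] using this

theorem Lprod_Lgradx (f : Phase → ℝ) (z : Phase) (v : V3) :
    Lprod (Lgradx f z) v = fderiv ℝ f z (v, 0) := by
  have hv : ((v, 0) : Phase) = v 0 • ((Pi.single 0 1 : V3), (0 : V3)) +
      v 1 • ((Pi.single 1 1 : V3), (0 : V3)) + v 2 • ((Pi.single 2 1 : V3), (0 : V3)) := by
    ext i
    · fin_cases i <;> simp
    · simp
  rw [hv]
  simp only [map_add, map_smul, smul_eq_mul, Lprod, Lgradx, sgn3,
    show (0 : Fin 3) ≠ 2 by decide, show (1 : Fin 3) ≠ 2 by decide, if_true, if_false]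
  ring

theorem Lprod_Lgrady (f : Phase → ℝ) (z : Phase) (v : V3) :
    Lprod (Lgrady f z) v = fderiv ℝ f z (0, v) := by
  have hv : ((0, v) : Phase) = v 0 • ((0 : V3), (Pi.single 0 1 : V3)) +
      v 1 • ((0 : V3), (Pi.single 1 1 : V3)) + v 2 • ((0 : V3), (Pi.single 2 1 : V3)) := by
    ext i
    · simp
    · fin_cases i <;> simp
  rw [hv]
  simp only [map_add, map_smul, smul_eq_mul, Lprod, Lgrady, sgn3,
    show (0 : Fin 3) ≠ 2 by decide, show (1 : Fin 3) ≠ 2 by decide, if_true, if_false]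
  ring

theorem surjective_of_Lprod_map {A : V3 →ₗ[ℝ] V3}
    (hA : ∀ u v : V3, Lprod (A u) (A v) = Lprod u v) : Function.Surjective A := by
  refine LinearMap.surjective_of_injective fun u v h => Lprod_eq_of_forall fun w => ?_
  rw [← hA u w, h, hA]

theorem fderiv_comp_prodMap (A : V3 →ₗ[ℝ] V3) {f : Phase → ℝ} (hf : Differentiable ℝ f)
    (z w : Phase) : fderiv ℝ (fun w => f (A w.1, A w.2)) z w =
      fderiv ℝ f (A z.1, A z.2) (A w.1, A w.2) := by
  let B : Phase →L[ℝ] Phase := A.toContinuousLinearMap.prodMap A.toContinuousLinearMap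
  have h := (hf (B z)).hasFDerivAt.comp z B.hasFDerivAt
  exact congrArg (fun L : Phase →L[ℝ] ℝ => L w) h.fderiv

theorem map_Lgradx_comp {A : V3 →ₗ[ℝ] V3}
    (hA : ∀ u v : V3, Lprod (A u) (A v) = Lprod u v)
    {f : Phase → ℝ} (hf : Differentiable ℝ f) (z : Phase) :
    A (Lgradx (fun w => f (A w.1, A w.2)) z) = Lgradx f (A z.1, A z.2) := by
  refine Lprod_eq_of_forall fun w => ?_
  obtain ⟨v, rfl⟩ := surjective_of_Lprod_map hA w
  rw [hA, Lprod_Lgradx, Lprod_Lgradx, fderiv_comp_prodMap A hf, map_zero]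

theorem map_Lgrady_comp {A : V3 →ₗ[ℝ] V3}
    (hA : ∀ u v : V3, Lprod (A u) (A v) = Lprod u v)
    {f : Phase → ℝ} (hf : Differentiable ℝ f) (z : Phase) :
    A (Lgrady (fun w => f (A w.1, A w.2)) z) = Lgrady f (A z.1, A z.2) := by
  refine Lprod_eq_of_forall fun w => ?_
  obtain ⟨v, rfl⟩ := surjective_of_Lprod_map hA w
  rw [hA, Lprod_Lgrady, Lprod_Lgrady, fderiv_comp_prodMap A hf, map_zero]

theorem pb_comp {A : V3 →ₗ[ℝ] V3} (hA : ∀ u v : V3, Lprod (A u) (A v) = Lprod u v)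
    {f g : Phase → ℝ} (hf : Differentiable ℝ f) (hg : Differentiable ℝ g) (z : Phase) :
    pb (fun w => f (A w.1, A w.2)) (fun w => g (A w.1, A w.2)) z = pb f g (A z.1, A z.2) := by
  simp only [pb, ← map_Lgradx_comp hA hf, ← map_Lgradx_comp hA hg, ← map_Lgrady_comp hA hf,
    ← map_Lgrady_comp hA hg, hA]

theorem differentiable_c1 : Differentiable ℝ c1 := by
  unfold c1 Lprod
  fun_prop

theorem differentiable_c2 : Differentiable ℝ c2 := by
  unfold c2 Lprod
  fun_prop

theorem dpb_comp {A : V3 →ₗ[ℝ] V3} (hA : ∀ u v : V3, Lprod (A u) (A v) = Lprod u v)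
    {f g : Phase → ℝ} (hf : Differentiable ℝ f) (hg : Differentiable ℝ g) (z : Phase) :
    dpb (fun w => f (A w.1, A w.2)) (fun w => g (A w.1, A w.2)) z = dpb f g (A z.1, A z.2) := by
  have h1 : (fun w : Phase => c1 (A w.1, A w.2)) = c1 := by
    funext w
    simp only [c1, hA]
  have h2 : (fun w : Phase => c2 (A w.1, A w.2)) = c2 := by
    funext w
    simp only [c2, hA]
  have hf1 := pb_comp hA hf differentiable_c1 z
  have hf2 := pb_comp hA hf differentiable_c2 z
  have hg1 := pb_comp hA hg differentiable_c1 z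
  have hg2 := pb_comp hA hg differentiable_c2 z
  rw [h1] at hf1 hg1
  rw [h2] at hf2 hg2
  simp only [dpb, pb_comp hA hf hg, hf1, hf2, hg1, hg2, hA]

/-- if `A ∈ O(2,1)` and `Ã(x,y) = (Ax,Ay)`, then
`{f∘Ã, g∘Ã}* = {f,g}*∘Ã` at every point with `⟨x,x⟩_L ≠ 0`; in particular
the Dirac–Poisson bracket of `Ã`-invariant functions is invariant. -/
theorem dirac_poisson_bracket_equivariant (A : V3 →ₗ[ℝ] V3)
    (hA : ∀ u v : V3, Lprod (A u) (A v) = Lprod u v)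
    (f g : Phase → ℝ) (hf : Differentiable ℝ f) (hg : Differentiable ℝ g) :
    (∀ z : Phase, Lprod z.1 z.1 ≠ 0 →
      dpb (fun w => f (A w.1, A w.2)) (fun w => g (A w.1, A w.2)) z = dpb f g (A z.1, A z.2)) ∧
    ((∀ z : Phase, f (A z.1, A z.2) = f z) → (∀ z : Phase, g (A z.1, A z.2) = g z) →
      ∀ z : Phase, Lprod z.1 z.1 ≠ 0 → dpb f g (A z.1, A z.2) = dpb f g z) := by
  refine ⟨fun z _ => dpb_comp hA hf hg z, fun hfA hgA z _ => ?_⟩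
  rw [← dpb_comp hA hf hg z, funext hfA, funext hgA]
end
end

section
/- Let Ũ : ℝ → ℝ be smooth and set U(x) = Ũ(x₃). If (x,y) : I → ℝ³×ℝ³ is a differentiable solution of the constrained equations of motion ẋ = y, ẏ = −∇_L U(x) + x(⟨y,y⟩_L − ⟨x, ∇_L U(x)⟩_L) on an interval I, then the momentum J_e(x,y) = x₁y₂ − x₂y₁ is constant along the solution: t ↦ x₁(t)y₂(t) − x₂(t)y₁(t) is constant on I. -/
noncomputable section

/-- The partial derivatives of `v ↦ f (v 2)` in directions other than the third vanish. -/
lemma Lgrad_comp_third_eq_zero {f : ℝ → ℝ} (hf : Differentiable ℝ f) (v : V3) {i : Fin 3}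
    (hi : i ≠ 2) : Lgrad (fun w => f (w 2)) v i = 0 := by
  have h : HasFDerivAt (fun w : V3 => f (w 2)) _ v :=
    (hf (v 2)).hasDerivAt.comp_hasFDerivAt v
      (ContinuousLinearMap.proj (R := ℝ) (φ := fun _ : Fin 3 => ℝ) 2).hasFDerivAt
  simp [Lgrad, h.fderiv, Pi.single_eq_of_ne hi.symm]

/-- for `U(x) = Ũ(x₃)`, the momentum `J_e = x₁y₂ − x₂y₁` is constant along
any differentiable solution of the constrained equations of motion
`ẋ = y`, `ẏ = −∇_L U(x) + x(⟨y,y⟩_L − ⟨x, ∇_L U(x)⟩_L)` on an interval `I`. -/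
theorem momentum_conservation_elliptic (Ut : ℝ → ℝ) (hUt : ContDiff ℝ (⊤ : ℕ∞) Ut)
    (I : Set ℝ) (hI : I.OrdConnected) (x y : ℝ → V3)
    (hx : ∀ t ∈ I, HasDerivAt x (y t) t)
    (hy : ∀ t ∈ I, HasDerivAt y
      (-(Lgrad (fun v => Ut (v 2)) (x t)) +
        (Lprod (y t) (y t) - Lprod (x t) (Lgrad (fun v => Ut (v 2)) (x t))) • x t) t) :
    ∀ t ∈ I, ∀ s ∈ I,
      x t 0 * y t 1 - x t 1 * y t 0 = x s 0 * y s 1 - x s 1 * y s 0 := by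
  have hUd : Differentiable ℝ Ut := hUt.differentiable (by simp)
  have hJ : ∀ t ∈ I, HasDerivAt (fun t => x t 0 * y t 1 - x t 1 * y t 0) 0 t := by
    intro t ht
    have hx' := hasDerivAt_pi.1 (hx t ht)
    have hy' := hasDerivAt_pi.1 (hy t ht)
    refine (((hx' 0).mul (hy' 1)).sub ((hx' 1).mul (hy' 0))).congr_deriv ?_
    simp only [Pi.add_apply, Pi.neg_apply, Pi.smul_apply, smul_eq_mul,
      Lgrad_comp_third_eq_zero hUd (x t) (show (0 : Fin 3) ≠ 2 by decide),
      Lgrad_comp_third_eq_zero hUd (x t) (show (1 : Fin 3) ≠ 2 by decide)]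
    ring
  intro t ht s hs
  have h := hI.convex.norm_image_sub_le_of_norm_hasDerivWithin_le (C := 0)
    (fun r hr => (hJ r hr).hasDerivWithinAt) (fun _ _ => norm_zero.le) hs ht
  rw [zero_mul, norm_le_zero_iff] at h
  exact sub_eq_zero.1 h
end
end

section
/- Let Ũ : ℝ → ℝ be smooth and set U(x) = Ũ(x₁). If (x,y) : I → ℝ³×ℝ³ is a differentiable solution of the constrained equations of motion ẋ = y, ẏ = −∇_L U(x) + x(⟨y,y⟩_L − ⟨x, ∇_L U(x)⟩_L) on an interval I, then the momentum J_h(x,y) = x₃y₂ − x₂y₃ is constant along the solution: t ↦ x₃(t)y₂(t) − x₂(t)y₃(t) is constant on I. -/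
noncomputable section

/-- The Lorentz gradient of a function of the first coordinate has no other components. -/
theorem Lgrad_comp_zero_apply {Ut : ℝ → ℝ} {v : V3} (hUt : DifferentiableAt ℝ Ut (v 0))
    {i : Fin 3} (hi : i ≠ 0) : Lgrad (fun w => Ut (w 0)) v i = 0 := by
  have h0 : HasFDerivAt (fun w : V3 => w 0)
      (ContinuousLinearMap.proj (R := ℝ) (φ := fun _ : Fin 3 => ℝ) 0) v := hasFDerivAt_apply 0 v
  have h : HasFDerivAt (fun w : V3 => Ut (w 0)) _ v := hUt.hasDerivAt.comp_hasFDerivAt v h0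
  simp [Lgrad, h.fderiv, hi.symm]

/-- A real function with vanishing derivative on an order-connected set is constant there. -/
theorem Set.OrdConnected.eq_of_hasDerivAt_zero {I : Set ℝ} (hI : I.OrdConnected) {f : ℝ → ℝ}
    (hf : ∀ t ∈ I, HasDerivAt f 0 t) {t s : ℝ} (ht : t ∈ I) (hs : s ∈ I) : f t = f s := by
  have h := hI.convex.norm_image_sub_le_of_norm_hasDerivWithin_le (C := 0)
    (fun u hu => (hf u hu).hasDerivWithinAt) (fun u _ => by simp) hs ht
  rw [zero_mul, norm_le_zero_iff] at h
  exact sub_eq_zero.mp h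

/-- for `U(x) = Ũ(x₁)`, the momentum `J_h = x₃y₂ − x₂y₃` is constant along
any differentiable solution of the constrained equations of motion
`ẋ = y`, `ẏ = −∇_L U(x) + x(⟨y,y⟩_L − ⟨x, ∇_L U(x)⟩_L)` on an interval `I`. -/
theorem momentum_conservation_hyperbolic (Ut : ℝ → ℝ) (hUt : ContDiff ℝ (⊤ : ℕ∞) Ut)
    (I : Set ℝ) (hI : I.OrdConnected) (x y : ℝ → V3)
    (hx : ∀ t ∈ I, HasDerivAt x (y t) t)
    (hy : ∀ t ∈ I, HasDerivAt y
      (-(Lgrad (fun v => Ut (v 0)) (x t)) +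
        (Lprod (y t) (y t) - Lprod (x t) (Lgrad (fun v => Ut (v 0)) (x t))) • x t) t) :
    ∀ t ∈ I, ∀ s ∈ I,
      x t 2 * y t 1 - x t 1 * y t 2 = x s 2 * y s 1 - x s 1 * y s 2 := by
  intro t ht s hs
  refine hI.eq_of_hasDerivAt_zero (f := fun r => x r 2 * y r 1 - x r 1 * y r 2)
    (fun r hr => ?_) ht hs
  have hU : DifferentiableAt ℝ Ut (x r 0) := hUt.differentiable (by simp) _
  have hx' := hasDerivAt_pi.mp (hx r hr)
  have hy' := hasDerivAt_pi.mp (hy r hr)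
  refine (((hx' 2).mul (hy' 1)).sub ((hx' 1).mul (hy' 2))).congr_deriv ?_
  simp only [Pi.add_apply, Pi.neg_apply, Pi.smul_apply, smul_eq_mul,
    Lgrad_comp_zero_apply hU (show (1 : Fin 3) ≠ 0 by decide),
    Lgrad_comp_zero_apply hU (show (2 : Fin 3) ≠ 0 by decide)]
  ring
end
end

section
/- Let Ũ : ℝ → ℝ be smooth and set U(x) = Ũ(x₂ − x₃). If (x,y) : I → ℝ³×ℝ³ is a differentiable solution of the constrained equations of motion ẋ = y, ẏ = −∇_L U(x) + x(⟨y,y⟩_L − ⟨x, ∇_L U(x)⟩_L) on an interval I, then the momentum J_p(x,y) = x₁(y₂ − y₃) + y₁(x₃ − x₂) is constant along the solution: t ↦ x₁(t)(y₂(t) − y₃(t)) + y₁(t)(x₃(t) − x₂(t)) is constant on I. -/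
noncomputable section

lemma fderiv_comp_coord_sub {Ut : ℝ → ℝ} (hUt : Differentiable ℝ Ut) (x w : V3) :
    fderiv ℝ (fun v : V3 => Ut (v 1 - v 2)) x w = deriv Ut (x 1 - x 2) * (w 1 - w 2) := by
  have h : HasFDerivAt (fun v : V3 => v 1 - v 2)
      (ContinuousLinearMap.proj (R := ℝ) (φ := fun _ : Fin 3 => ℝ) 1 -
        ContinuousLinearMap.proj (R := ℝ) (φ := fun _ : Fin 3 => ℝ) 2) x :=
    (hasFDerivAt_apply 1 x).sub (hasFDerivAt_apply 2 x)
  have h' : HasFDerivAt (fun v : V3 => Ut (v 1 - v 2)) _ x :=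
    (hUt (x 1 - x 2)).hasDerivAt.comp_hasFDerivAt x h
  rw [h'.fderiv]
  simp

lemma Lgrad_comp_coord_sub {Ut : ℝ → ℝ} (hUt : Differentiable ℝ Ut) (x : V3) :
    Lgrad (fun v => Ut (v 1 - v 2)) x =
      ![0, deriv Ut (x 1 - x 2), deriv Ut (x 1 - x 2)] := by
  ext i
  fin_cases i <;> simp [Lgrad, sgn3, fderiv_comp_coord_sub hUt]

lemma hasDerivAt_parabolic_momentum {x y : ℝ → V3} {t c μ : ℝ}
    (hx : HasDerivAt x (y t) t) (hy : HasDerivAt y (-![0, c, c] + μ • x t) t) :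
    HasDerivAt (fun s => x s 0 * (y s 1 - y s 2) + y s 0 * (x s 2 - x s 1)) 0 t := by
  have hx' := hasDerivAt_pi.1 hx
  have hy' := hasDerivAt_pi.1 hy
  refine (((hx' 0).mul ((hy' 1).sub (hy' 2))).add
    ((hy' 0).mul ((hx' 2).sub (hx' 1)))).congr_deriv ?_
  simp
  ring

/-- for `U(x) = Ũ(x₂ − x₃)`, the momentum
`J_p = x₁(y₂ − y₃) + y₁(x₃ − x₂)` is constant along any differentiable solution of the
constrained equations of motion on an interval `I`. -/
theorem momentum_conservation_parabolic (Ut : ℝ → ℝ) (hUt : ContDiff ℝ (⊤ : ℕ∞) Ut)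
    (I : Set ℝ) (hI : I.OrdConnected) (x y : ℝ → V3)
    (hx : ∀ t ∈ I, HasDerivAt x (y t) t)
    (hy : ∀ t ∈ I, HasDerivAt y
      (-(Lgrad (fun v => Ut (v 1 - v 2)) (x t)) +
        (Lprod (y t) (y t) - Lprod (x t) (Lgrad (fun v => Ut (v 1 - v 2)) (x t))) • x t) t) :
    ∀ t ∈ I, ∀ s ∈ I,
      x t 0 * (y t 1 - y t 2) + y t 0 * (x t 2 - x t 1)
        = x s 0 * (y s 1 - y s 2) + y s 0 * (x s 2 - x s 1) := by
  intro t ht s hs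
  have hU : Differentiable ℝ Ut := hUt.differentiable (by simp)
  simp only [Lgrad_comp_coord_sub hU] at hy
  have h := hI.convex.norm_image_sub_le_of_norm_hasDerivWithin_le (C := 0)
    (fun r hr => (hasDerivAt_parabolic_momentum (hx r hr) (hy r hr)).hasDerivWithinAt)
    (fun r _ => by simp) hs ht
  simpa [sub_eq_zero] using h
end
end

section
/- Fix α ∈ ℂ, α ≠ 0, and consider the one-parameter group of linear maps T_t = diag(e^{αt}, e^{−αt}, 1, e^{αt}, e^{−αt}, 1) acting on ℂ⁶ with coordinates z₁,…,z₆ (for t ∈ ℂ). A polynomial p ∈ ℂ[z₁,…,z₆] satisfies p∘T_t = p for all t if and only if p belongs to the subalgebra generated by ψ₁ = z₁z₂, ψ₂ = z₃, ψ₃ = z₄z₅, ψ₄ = z₆, ψ₅ = z₁z₅, ψ₆ = z₂z₄. Moreover the kernel of the algebra homomorphism ℂ[w₁,…,w₆] → ℂ[z₁,…,z₆] sending w_i to ψ_i is the ideal generated by the single polynomial w₁w₃ − w₅w₆. -/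
open MvPolynomial

/-- A monic monomial in six variables, written out as a product of powers. -/
theorem MvPolynomial.monomial_fin_six {R : Type*} [CommSemiring R] (d : Fin 6 →₀ ℕ) :
    (monomial d 1 : MvPolynomial (Fin 6) R) =
      X 0 ^ d 0 * X 1 ^ d 1 * X 2 ^ d 2 * X 3 ^ d 3 * X 4 ^ d 4 * X 5 ^ d 5 := by
  rw [monomial_eq, Finsupp.prod_fintype _ _ (fun i => pow_zero _), Fin.prod_univ_six, C_1, one_mul]

/-- Rescaling the variables rescales each coefficient. -/
theorem MvPolynomial.coeff_aeval_C_mul_X {σ R : Type*} [CommSemiring R] (s : σ → R)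
    (p : MvPolynomial σ R) (d : σ →₀ ℕ) :
    coeff d (aeval (fun i => C (s i) * X i : σ → MvPolynomial σ R) p) =
      (d.prod fun i k => s i ^ k) * coeff d p := by
  classical
  induction p using MvPolynomial.induction_on' with
  | add p q hp hq => rw [map_add, coeff_add, coeff_add, hp, hq, mul_add]
  | monomial e a =>
    have h : aeval (fun i => C (s i) * X i : σ → MvPolynomial σ R) (monomial e a) =
        monomial e ((e.prod fun i k => s i ^ k) * a) := by
      rw [aeval_monomial, monomial_eq, algebraMap_eq]
      simp only [mul_pow, Finsupp.prod_mul, C_mul]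
      simp only [Finsupp.prod, map_prod, map_pow]
      ring
    rw [h, coeff_monomial, coeff_monomial]
    split_ifs with hed
    · rw [hed]
    · rw [mul_zero]

/-- A monomial of weight zero is a product of the six basic invariants. -/
theorem monomial_mem_adjoin_of_weight_eq {R : Type*} [CommSemiring R] (d : Fin 6 →₀ ℕ)
    (hd : d 0 + d 3 = d 1 + d 4) :
    (monomial d 1 : MvPolynomial (Fin 6) R) ∈ Algebra.adjoin R
      ({X 0 * X 1, X 2, X 3 * X 4, X 5, X 0 * X 4, X 1 * X 3} :
        Set (MvPolynomial (Fin 6) R)) := by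
  set S : Set (MvPolynomial (Fin 6) R) := {X 0 * X 1, X 2, X 3 * X 4, X 5, X 0 * X 4, X 1 * X 3}
    with hS
  have hmem (a b c e f g : ℕ) : ((X 0 * X 1) ^ a * X 2 ^ b * (X 3 * X 4) ^ c * X 5 ^ e *
      (X 0 * X 4) ^ f * (X 1 * X 3) ^ g : MvPolynomial (Fin 6) R) ∈ Algebra.adjoin R S := by
    refine mul_mem (mul_mem (mul_mem (mul_mem (mul_mem ?_ ?_) ?_) ?_) ?_) ?_ <;>
    exact pow_mem (Algebra.subset_adjoin (by simp [hS])) _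
  rw [monomial_fin_six]
  rcases le_total (d 0) (d 1) with h | h
  · obtain ⟨k, hk⟩ := Nat.exists_eq_add_of_le h
    have h3 : d 3 = k + d 4 := by omega
    convert hmem (d 0) (d 2) (d 4) (d 5) 0 k using 1
    rw [hk, h3]
    ring
  · obtain ⟨k, hk⟩ := Nat.exists_eq_add_of_le h
    have h4 : d 4 = k + d 3 := by omega
    convert hmem (d 1) (d 2) (d 3) (d 5) k 0 using 1
    rw [hk, h4]
    ring

/-- If a polynomial is fixed by the element of the torus with `e ^ (α t) = e`, then all its
monomials have weight zero. -/
theorem weight_eq_of_invariant {p : MvPolynomial (Fin 6) ℂ}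
    (hp : ∀ z : Fin 6 → ℂ, eval (fun i =>
      (![Complex.exp 1, Complex.exp (-1), 1, Complex.exp 1, Complex.exp (-1), 1] :
        Fin 6 → ℂ) i * z i) p = eval z p)
    {d : Fin 6 →₀ ℕ} (hd : coeff d p ≠ 0) : d 0 + d 3 = d 1 + d 4 := by
  set s : Fin 6 → ℂ :=
    ![Complex.exp 1, Complex.exp (-1), 1, Complex.exp 1, Complex.exp (-1), 1] with hs
  have hfix : aeval (fun i => C (s i) * X i : Fin 6 → MvPolynomial (Fin 6) ℂ) p = p := by
    refine MvPolynomial.funext fun z => ?_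
    rw [← hp z, ← coe_aeval_eq_eval, ← coe_aeval_eq_eval]
    simp only [RingHom.coe_coe]
    rw [← AlgHom.comp_apply, comp_aeval]
    simp
  have hprod : (d.prod fun i k => s i ^ k) = 1 := by
    have h := coeff_aeval_C_mul_X s p d
    rw [hfix] at h
    exact mul_right_cancel₀ hd (by rw [← h, one_mul])
  rw [Finsupp.prod_fintype _ _ (fun i => pow_zero _), Fin.prod_univ_six] at hprod
  simp only [hs, Matrix.cons_val, one_pow, mul_one, ← Complex.exp_nat_mul, ← Complex.exp_add]
    at hprod
  have hre := congrArg norm hprod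
  rw [Complex.norm_exp, norm_one, Real.exp_eq_one_iff] at hre
  simp at hre
  have hreal : (d 0 : ℝ) + d 3 = d 1 + d 4 := by linarith
  exact_mod_cast hreal

/-- Rewriting `x * y` to `u * v` in a monomial until `x` or `y` is used up. -/
theorem pow_mul_pow_eq_of_mul_eq {M : Type*} [CommMonoid M] {x y u v : M} (h : x * y = u * v)
    (a b m n : ℕ) :
    x ^ a * y ^ b * u ^ m * v ^ n =
      x ^ (a - b) * y ^ (b - a) * u ^ (m + min a b) * v ^ (n + min a b) := by
  have ha : a = (a - b) + min a b := by omega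
  have hb : b = (b - a) + min a b := by omega
  calc x ^ a * y ^ b * u ^ m * v ^ n
      = x ^ ((a - b) + min a b) * y ^ ((b - a) + min a b) * u ^ m * v ^ n := by rw [← ha, ← hb]
    _ = x ^ (a - b) * y ^ (b - a) * (x * y) ^ min a b * (u ^ m * v ^ n) := by
        rw [pow_add, pow_add, mul_pow]; ac_rfl
    _ = _ := by rw [h, pow_add, pow_add, mul_pow]; ac_rfl

/-- The relations between the six basic invariants are generated by `w₁w₃ − w₅w₆`. -/
theorem ker_aeval_basic_invariants (R : Type*) [CommRing R] :
    RingHom.ker (aeval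
        (![X 0 * X 1, X 2, X 3 * X 4, X 5, X 0 * X 4, X 1 * X 3] :
          Fin 6 → MvPolynomial (Fin 6) R) :
        MvPolynomial (Fin 6) R →ₐ[R] MvPolynomial (Fin 6) R)
      = Ideal.span {X 0 * X 2 - X 4 * X 5} := by
  set φ : MvPolynomial (Fin 6) R →ₐ[R] MvPolynomial (Fin 6) R :=
    aeval ![X 0 * X 1, X 2, X 3 * X 4, X 5, X 0 * X 4, X 1 * X 3] with hφ
  set I : Ideal (MvPolynomial (Fin 6) R) := Ideal.span {X 0 * X 2 - X 4 * X 5} with hI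
  refine le_antisymm (fun p hp => ?_) ?_
  · let x : Fin 6 → MvPolynomial (Fin 6) R ⧸ I := fun i => Ideal.Quotient.mkₐ R I (X i)
    have hx : x 0 * x 2 = x 4 * x 5 := by
      simp only [x, ← map_mul]
      exact Ideal.Quotient.eq.2 (Ideal.subset_span rfl)
    let τ : MvPolynomial (Fin 6) R →ₗ[R] MvPolynomial (Fin 6) R ⧸ I :=
      (basisMonomials (Fin 6) R).constr R fun e =>
        x 0 ^ (e 0 - e 4) * x 2 ^ (e 4 - e 0) * x 4 ^ min (e 0) (e 4) *
          x 5 ^ (e 1 - (e 0 - e 4)) * (x 1 ^ e 2 * x 3 ^ e 5)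
    have hτ : τ ∘ₗ φ.toLinearMap = (Ideal.Quotient.mkₐ R I).toLinearMap := by
      refine (basisMonomials (Fin 6) R).ext fun d => ?_
      let e : Fin 6 →₀ ℕ := Finsupp.equivFunOnFinite.symm
        ![d 0 + d 4, d 0 + d 5, d 1, d 2 + d 5, d 2 + d 4, d 3]
      have hφd : φ (monomial d 1) = monomial e 1 := by
        rw [monomial_fin_six, monomial_fin_six]
        simp [hφ, e]
        ring
      have hτe := (basisMonomials (Fin 6) R).constr_basis R (fun e : Fin 6 →₀ ℕ =>
        x 0 ^ (e 0 - e 4) * x 2 ^ (e 4 - e 0) * x 4 ^ min (e 0) (e 4) *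
          x 5 ^ (e 1 - (e 0 - e 4)) * (x 1 ^ e 2 * x 3 ^ e 5)) e
      rw [coe_basisMonomials] at hτe ⊢
      simp only [LinearMap.comp_apply, AlgHom.toLinearMap_apply, hφd]
      refine hτe.trans ?_
      rw [monomial_fin_six]
      simp only [map_mul, map_pow]
      change _ = x 0 ^ d 0 * x 1 ^ d 1 * x 2 ^ d 2 * x 3 ^ d 3 * x 4 ^ d 4 * x 5 ^ d 5
      have hnf := pow_mul_pow_eq_of_mul_eq hx (d 0) (d 2) (d 4) (d 5)
      have e0 : e 0 = d 0 + d 4 := rfl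
      have e1 : e 1 = d 0 + d 5 := rfl
      have e2 : e 2 = d 1 := rfl
      have e4 : e 4 = d 2 + d 4 := rfl
      have e5 : e 5 = d 3 := rfl
      have h04 : e 0 - e 4 = d 0 - d 2 := by omega
      have h40 : e 4 - e 0 = d 2 - d 0 := by omega
      have hmin : min (e 0) (e 4) = d 4 + min (d 0) (d 2) := by omega
      have h1 : e 1 - (d 0 - d 2) = d 5 + min (d 0) (d 2) := by omega
      rw [h04, h40, hmin, h1, e2, e5, ← hnf]
      ring
    have hp0 : φ p = 0 := hp
    have h := LinearMap.congr_fun hτ p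
    simp only [LinearMap.comp_apply, AlgHom.toLinearMap_apply, hp0, map_zero] at h
    exact Ideal.Quotient.eq_zero_iff_mem.1 h.symm
  · rw [hI, Ideal.span_le, Set.singleton_subset_iff, SetLike.mem_coe, RingHom.mem_ker]
    simp [hφ]
    ring

/-- invariants of the one-parameter group
`T_t = diag(e^{αt}, e^{−αt}, 1, e^{αt}, e^{−αt}, 1)` on `ℂ⁶`.  A polynomial is invariant
iff it lies in the subalgebra generated by
`ψ₁ = z₁z₂, ψ₂ = z₃, ψ₃ = z₄z₅, ψ₄ = z₆, ψ₅ = z₁z₅, ψ₆ = z₂z₄`, and the ideal of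
relations between the `ψᵢ` is generated by `w₁w₃ − w₅w₆`. -/
theorem torus_invariants (α : ℂ) (hα : α ≠ 0) :
    (∀ p : MvPolynomial (Fin 6) ℂ,
      (∀ t : ℂ, ∀ z : Fin 6 → ℂ,
        eval (fun i =>
          (![Complex.exp (α * t), Complex.exp (-(α * t)), 1,
             Complex.exp (α * t), Complex.exp (-(α * t)), 1] : Fin 6 → ℂ) i * z i) p
          = eval z p)
        ↔ p ∈ Algebra.adjoin ℂ
            ({X 0 * X 1, X 2, X 3 * X 4, X 5, X 0 * X 4, X 1 * X 3} :
              Set (MvPolynomial (Fin 6) ℂ))) ∧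
    RingHom.ker (aeval
        (![X 0 * X 1, X 2, X 3 * X 4, X 5, X 0 * X 4, X 1 * X 3] :
          Fin 6 → MvPolynomial (Fin 6) ℂ) :
        MvPolynomial (Fin 6) ℂ →ₐ[ℂ] MvPolynomial (Fin 6) ℂ)
      = Ideal.span {X 0 * X 2 - X 4 * X 5} := by
  refine ⟨fun p => ⟨fun hp => ?_, fun hp t z => ?_⟩, ker_aeval_basic_invariants ℂ⟩
  · have hp1 := hp α⁻¹
    rw [mul_inv_cancel₀ hα] at hp1
    rw [p.as_sum]
    refine sum_mem fun d hd => ?_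
    have hmem := monomial_mem_adjoin_of_weight_eq (R := ℂ) d
      (weight_eq_of_invariant hp1 (mem_support_iff.1 hd))
    simpa [smul_monomial] using Subalgebra.smul_mem _ hmem (coeff d p)
  · have hexp : Complex.exp (α * t) * Complex.exp (-(α * t)) = 1 := by
      rw [← Complex.exp_add, add_neg_cancel, Complex.exp_zero]
    induction hp using Algebra.adjoin_induction with
    | mem q hq =>
      simp only [Set.mem_insert_iff, Set.mem_singleton_iff] at hq
      rcases hq with rfl | rfl | rfl | rfl | rfl | rfl <;> simp <;> grind
    | algebraMap r => simp [algebraMap_eq]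
    | add q r _ _ hq hr => rw [map_add, map_add, hq, hr]
    | mul q r _ _ hq hr => rw [map_mul, map_mul, hq, hr]
end

section
/- Let Γ : ℝ³×ℝ³ → ℝ⁴ be the map Γ(x,y) = (σ₁, σ₂, σ₃, σ₆)(x,y) with σ₁ = x₃, σ₂ = y₃, σ₃ = y₁²+y₂²−y₃², σ₆ = x₁y₂−x₂y₁. Then the image Γ(Tℍ²) of the tangent bundle Tℍ² equals the set of all w = (w₁,w₂,w₃,w₄) ∈ ℝ⁴ satisfying w₄² = (w₁²−1)w₃ − w₂² and belonging to the union of {w : w₁ > 1 and w₂² + w₃ > 0}, {(1,0,w₃,0) : w₃ ≥ 0}, and {(w₁,0,0,0) : w₁ ≥ 1}. -/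
noncomputable section

/-- The tangent bundle `Tℍ²` of the hyperbolic plane:
`{(x,y) : ⟨x,x⟩_L = −1, x₃ > 0, ⟨x,y⟩_L = 0}`. -/
def TH2 : Set (V3 × V3) := {z | Lprod z.1 z.1 = -1 ∧ 0 < z.1 2 ∧ Lprod z.1 z.2 = 0}

/-- the image of `Tℍ²` under `Γ = (σ₁,σ₂,σ₃,σ₆)` consists of the points of
the variety `w₄² = (w₁²−1)w₃ − w₂²` lying in the union of `{w₁ > 1, w₂²+w₃ > 0}`,
`{(1,0,w₃,0) : w₃ ≥ 0}` and `{(w₁,0,0,0) : w₁ ≥ 1}`. -/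
theorem elliptic_hilbert_map_image :
    (fun z : V3 × V3 =>
        (![z.1 2, z.2 2, (z.2 0) ^ 2 + (z.2 1) ^ 2 - (z.2 2) ^ 2,
           z.1 0 * z.2 1 - z.1 1 * z.2 0] : Fin 4 → ℝ)) '' TH2
      = {w : Fin 4 → ℝ |
          (w 3) ^ 2 = ((w 0) ^ 2 - 1) * w 2 - (w 1) ^ 2 ∧
          ((1 < w 0 ∧ 0 < (w 1) ^ 2 + w 2) ∨
           (w 0 = 1 ∧ w 1 = 0 ∧ w 3 = 0 ∧ 0 ≤ w 2) ∨
           (w 1 = 0 ∧ w 2 = 0 ∧ w 3 = 0 ∧ 1 ≤ w 0))} := by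
  ext w
  simp only [Set.mem_image, Set.mem_ofPred_eq]
  constructor
  · rintro ⟨⟨x, y⟩, ⟨hx, hpos, hxy⟩, rfl⟩
    simp only [Lprod] at hx hpos hxy
    simp only [Matrix.cons_val]
    have hone : 1 ≤ x 2 := by nlinarith [sq_nonneg (x 0), sq_nonneg (x 1)]
    have hdot : x 0 * y 0 + x 1 * y 1 = x 2 * y 2 := by linarith
    have hnorm : x 0 ^ 2 + x 1 ^ 2 = x 2 ^ 2 - 1 := by linarith
    refine ⟨?_, ?_⟩
    · linear_combination (y 0 ^ 2 + y 1 ^ 2) * hnorm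
        - (x 0 * y 0 + x 1 * y 1 + x 2 * y 2) * hdot
    · rcases hone.eq_or_lt with h | h
      · have h0 : x 0 = 0 := by nlinarith [sq_nonneg (x 0), sq_nonneg (x 1)]
        have h1 : x 1 = 0 := by nlinarith [sq_nonneg (x 0), sq_nonneg (x 1)]
        have hy : y 2 = 0 := by
          rw [h0, h1, ← h] at hdot
          linarith
        refine Or.inr (Or.inl ⟨h.symm, hy, by simp [h0, h1], ?_⟩)
        rw [hy]
        nlinarith [sq_nonneg (y 0), sq_nonneg (y 1)]
      · by_cases hy : 0 < y 0 ^ 2 + y 1 ^ 2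
        · exact Or.inl ⟨h, by linarith⟩
        · have h0 : y 0 = 0 := by nlinarith [sq_nonneg (y 0), sq_nonneg (y 1)]
          have h1 : y 1 = 0 := by nlinarith [sq_nonneg (y 0), sq_nonneg (y 1)]
          have h2 : y 2 = 0 := by
            rw [h0, h1, mul_zero, mul_zero, add_zero] at hdot
            exact (mul_eq_zero.mp hdot.symm).resolve_left hpos.ne'
          exact Or.inr (Or.inr ⟨h2, by simp [h0, h1, h2], by simp [h0, h1], hone⟩)
  · rintro ⟨hw, ⟨h, -⟩ | ⟨h0, h1, h3, h2⟩ | ⟨h1, h2, h3, h0⟩⟩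
    · have hr : 0 < w 0 ^ 2 - 1 := by nlinarith
      have hs := Real.sq_sqrt hr.le
      have hne := (Real.sqrt_pos.mpr hr).ne'
      set r := √(w 0 ^ 2 - 1)
      refine ⟨(![r, 0, w 0], ![w 0 * w 1 / r, w 3 / r, w 1]), ⟨?_, ?_, ?_⟩, ?_⟩
      · simp only [Lprod, Matrix.cons_val]
        linarith
      · simp only [Matrix.cons_val]
        linarith
      · simp only [Lprod, Matrix.cons_val]
        field_simp
        ring
      · have hy : (w 0 * w 1 / r) ^ 2 + (w 3 / r) ^ 2 - w 1 ^ 2 = w 2 := by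
          field_simp
          linear_combination hw - (w 1 ^ 2 + w 2) * hs
        have hz : r * (w 3 / r) - 0 * (w 0 * w 1 / r) = w 3 := by
          field_simp
          ring
        ext i
        fin_cases i
        exacts [rfl, rfl, hy, hz]
    · refine ⟨(![0, 0, 1], ![√(w 2), 0, 0]), ⟨?_, ?_, ?_⟩, ?_⟩
      · simp [Lprod]
      · simp
      · simp [Lprod]
      · ext i
        fin_cases i <;> simp [h0, h1, h3, Real.sq_sqrt h2]
    · have hs := Real.sq_sqrt (show 0 ≤ w 0 ^ 2 - 1 by nlinarith)
      refine ⟨(![√(w 0 ^ 2 - 1), 0, w 0], 0), ⟨?_, ?_, ?_⟩, ?_⟩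
      · simp only [Lprod, Matrix.cons_val]
        linarith
      · simp only [Matrix.cons_val]
        linarith
      · simp [Lprod]
      · ext i
        fin_cases i <;> simp [h1, h2, h3]
end
end

section
/- Let Ũ : ℝ → ℝ be smooth and U(x) = Ũ(x₃). If (x,y) : I → ℝ³×ℝ³ is a differentiable solution of the constrained equations of motion ẋ = y, ẏ = −∇_L U(x) + x(⟨y,y⟩_L − ⟨x, ∇_L U(x)⟩_L) with (x(t),y(t)) ∈ Tℍ² for all t ∈ I, then w(t) = (x₃(t), y₃(t), y₁(t)²+y₂(t)²−y₃(t)², x₁(t)y₂(t)−x₂(t)y₁(t)) satisfies the reduced system ẇ₁ = w₂, ẇ₂ = w₁w₃ + (1−w₁²)Ũ′(w₁), ẇ₃ = −2w₂Ũ′(w₁), ẇ₄ = 0 on I. -/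
noncomputable section

theorem Lgrad_comp_third {Ut : ℝ → ℝ} {v : V3} (h : DifferentiableAt ℝ Ut (v 2)) :
    Lgrad (fun v => Ut (v 2)) v = Pi.single 2 (-deriv Ut (v 2)) := by
  have hf : HasFDerivAt (fun v : V3 => Ut (v 2))
      (deriv Ut (v 2) • (ContinuousLinearMap.proj 2 : V3 →L[ℝ] ℝ)) v :=
    h.hasDerivAt.comp_hasFDerivAt v (hasFDerivAt_apply 2 v)
  ext i
  fin_cases i <;> simp [Lgrad, sgn3, hf.fderiv]

/-- for `U(x) = Ũ(x₃)`, a solution of the constrained equations of motion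
lying in `Tℍ²` is mapped by `w = (x₃, y₃, y₁²+y₂²−y₃², x₁y₂−x₂y₁)` to a solution of the
reduced system `ẇ₁ = w₂`, `ẇ₂ = w₁w₃ + (1−w₁²)Ũ′(w₁)`, `ẇ₃ = −2w₂Ũ′(w₁)`, `ẇ₄ = 0`. -/
theorem elliptic_reduced_system (Ut : ℝ → ℝ) (hUt : ContDiff ℝ (⊤ : ℕ∞) Ut)
    (I : Set ℝ) (hI : I.OrdConnected) (x y : ℝ → V3)
    (hmem : ∀ t ∈ I, (x t, y t) ∈ TH2)
    (hx : ∀ t ∈ I, HasDerivAt x (y t) t)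
    (hy : ∀ t ∈ I, HasDerivAt y
      (-(Lgrad (fun v => Ut (v 2)) (x t)) +
        (Lprod (y t) (y t) - Lprod (x t) (Lgrad (fun v => Ut (v 2)) (x t))) • x t) t) :
    ∀ t ∈ I,
      HasDerivAt (fun u => x u 2) (y t 2) t ∧
      HasDerivAt (fun u => y u 2)
        (x t 2 * ((y t 0)^2 + (y t 1)^2 - (y t 2)^2)
          + (1 - (x t 2)^2) * deriv Ut (x t 2)) t ∧
      HasDerivAt (fun u => (y u 0)^2 + (y u 1)^2 - (y u 2)^2)
        (-2 * y t 2 * deriv Ut (x t 2)) t ∧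
      HasDerivAt (fun u => x u 0 * y u 1 - x u 1 * y u 0) 0 t := by
  intro t ht
  have hgrad := Lgrad_comp_third (v := x t) (hUt.differentiable (by simp) (x t 2))
  have hxi := hasDerivAt_pi.1 (hx t ht)
  have hyi := hasDerivAt_pi.1 (hy t ht)
  have horth : x t 0 * y t 0 + x t 1 * y t 1 - x t 2 * y t 2 = 0 := (hmem t ht).2.2
  simp only [hgrad, Lprod, Pi.add_apply, Pi.neg_apply, Pi.smul_apply, smul_eq_mul] at hyi
  have hy0 := hyi 0
  have hy1 := hyi 1
  have hy2 := hyi 2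
  simp only [Pi.single_eq_same, Pi.single_eq_of_ne (show (0 : Fin 3) ≠ 2 by decide),
    Pi.single_eq_of_ne (show (1 : Fin 3) ≠ 2 by decide)] at hy0 hy1 hy2
  refine ⟨hxi 2, ?_, ?_, ?_⟩
  · exact hy2.congr_deriv (by ring)
  · refine (((hy0.fun_pow 2).fun_add (hy1.fun_pow 2)).fun_sub (hy2.fun_pow 2)).congr_deriv ?_
    push_cast
    linear_combination (2 * (y t 0 * y t 0 + y t 1 * y t 1 - y t 2 * y t 2
      - x t 2 * deriv Ut (x t 2))) * horth
  · exact (((hxi 0).fun_mul hy1).fun_sub ((hxi 1).fun_mul hy0)).congr_deriv (by ring)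
end
end

section
/- Let Γ̃ : ℝ³×ℝ³ → ℝ³ be the map Γ̃(x,y) = (x₃, y₃, y₁²+y₂²−y₃²). Then a point w = (w₁,w₂,w₃) ∈ ℝ³ lies in Γ̃(Tℍ²) if and only if w₁ ≥ 1, w₂² + w₃ ≥ 0, and (w₁²−1)w₃ − w₂² ≥ 0. -/
noncomputable section

/-- `w ∈ Γ̃(Tℍ²)` for `Γ̃ = (x₃, y₃, y₁²+y₂²−y₃²)` iff
`w₁ ≥ 1`, `w₂² + w₃ ≥ 0` and `(w₁²−1)w₃ − w₂² ≥ 0`. -/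
theorem elliptic_reduced_image (w : Fin 3 → ℝ) :
    w ∈ (fun z : V3 × V3 =>
        (![z.1 2, z.2 2, (z.2 0) ^ 2 + (z.2 1) ^ 2 - (z.2 2) ^ 2] : Fin 3 → ℝ)) '' TH2
      ↔ 1 ≤ w 0 ∧ 0 ≤ (w 1) ^ 2 + w 2 ∧ 0 ≤ ((w 0) ^ 2 - 1) * w 2 - (w 1) ^ 2 := by
  constructor
  · rintro ⟨⟨x, y⟩, ⟨h1, h2, h3⟩, rfl⟩
    simp only [Lprod] at h1 h2 h3
    simp only [Matrix.cons_val_zero, Matrix.cons_val_one, Matrix.cons_val]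
    have hcross : (x 2 ^ 2 - 1) * (y 0 ^ 2 + y 1 ^ 2 - y 2 ^ 2) - y 2 ^ 2
        = (x 0 * y 1 - x 1 * y 0) ^ 2 := by
      have e1 : x 2 ^ 2 - 1 = x 0 ^ 2 + x 1 ^ 2 := by linarith
      have e2 : x 2 * y 2 = x 0 * y 0 + x 1 * y 1 := by linarith
      calc _ = (x 2 ^ 2 - 1) * (y 0 ^ 2 + y 1 ^ 2) - (x 2 * y 2) ^ 2 := by ring
        _ = _ := by rw [e1, e2]; ring
    refine ⟨?_, ?_, ?_⟩
    · nlinarith [sq_nonneg (x 0), sq_nonneg (x 1)]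
    · nlinarith [sq_nonneg (y 0), sq_nonneg (y 1)]
    · rw [hcross]; positivity
  · rintro ⟨h1, h2, h3⟩
    rcases h1.eq_or_lt with h | h
    · have hw1 : w 1 = 0 := by
        rw [← h] at h3
        exact pow_eq_zero_iff two_ne_zero |>.1 (by nlinarith [sq_nonneg (w 1)])
      have hw2 : 0 ≤ w 2 := by simpa [hw1] using h2
      refine ⟨(![0, 0, 1], ![√(w 2), 0, 0]), ⟨?_, ?_, ?_⟩, ?_⟩
      · simp [Lprod]
      · simp
      · simp [Lprod]
      · ext i
        fin_cases i <;> simp [Real.sq_sqrt hw2, hw1, ← h]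
    · have hpos : 0 < w 0 ^ 2 - 1 := by nlinarith
      set r := √(w 0 ^ 2 - 1) with hr
      have hr0 : 0 < r := Real.sqrt_pos.2 hpos
      have hr2 : r ^ 2 = w 0 ^ 2 - 1 := Real.sq_sqrt hpos.le
      have hd : 0 ≤ (w 0 ^ 2 - 1) * w 2 - w 1 ^ 2 := h3
      refine ⟨(![r, 0, w 0],
        ![w 0 * w 1 / r, √((w 0 ^ 2 - 1) * w 2 - w 1 ^ 2) / r, w 1]), ⟨?_, ?_, ?_⟩, ?_⟩
      · simp only [Lprod, Matrix.cons_val_zero, Matrix.cons_val_one, Matrix.cons_val]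
        linarith
      · simp only [Matrix.cons_val]
        linarith
      · simp only [Lprod, Matrix.cons_val_zero, Matrix.cons_val_one, Matrix.cons_val]
        field_simp
        ring
      · have key : (w 0 * w 1 / r) ^ 2 + (√((w 0 ^ 2 - 1) * w 2 - w 1 ^ 2) / r) ^ 2 - w 1 ^ 2
            = w 2 := by
          rw [div_pow, div_pow, Real.sq_sqrt hd, hr2]
          field_simp
          ring
        ext i
        fin_cases i
        · rfl
        · rfl
        · exact key
end
end

section
/- Let Ũ : ℝ → ℝ be smooth and consider the reduced elliptic vector field F(w) = (w₂, w₁w₃ + (1−w₁²)Ũ′(w₁), −2w₂Ũ′(w₁)) on the set S = {w ∈ ℝ³ : w₁ ≥ 1, w₂² + w₃ ≥ 0, (w₁²−1)w₃ − w₂² ≥ 0}. Then F(w) = 0 for w ∈ S if and only if either w = (1,0,0), or w = (ρ, 0, ((ρ²−1)/ρ)·Ũ′(ρ)) for some ρ > 1 with Ũ′(ρ) ≥ 0. -/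
/-- on the set
`S = {w : w₁ ≥ 1, w₂² + w₃ ≥ 0, (w₁²−1)w₃ − w₂² ≥ 0}`, the reduced elliptic vector
field `F(w) = (w₂, w₁w₃ + (1−w₁²)Ũ′(w₁), −2w₂Ũ′(w₁))` vanishes exactly at `(1,0,0)` and
at the points `(ρ, 0, ((ρ²−1)/ρ)Ũ′(ρ))` with `ρ > 1` and `Ũ′(ρ) ≥ 0`. -/
theorem elliptic_relative_equilibria (Ut : ℝ → ℝ) (hUt : ContDiff ℝ (⊤ : ℕ∞) Ut)
    (w : Fin 3 → ℝ)
    (hS : 1 ≤ w 0 ∧ 0 ≤ (w 1) ^ 2 + w 2 ∧ 0 ≤ ((w 0) ^ 2 - 1) * w 2 - (w 1) ^ 2) :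
    (![w 1,
       w 0 * w 2 + (1 - (w 0) ^ 2) * deriv Ut (w 0),
       -2 * w 1 * deriv Ut (w 0)] : Fin 3 → ℝ) = 0
      ↔ (w = ![1, 0, 0] ∨
         ∃ ρ : ℝ, 1 < ρ ∧ 0 ≤ deriv Ut ρ ∧
           w = ![ρ, 0, ((ρ ^ 2 - 1) / ρ) * deriv Ut ρ]) := by
  obtain ⟨h0, h1, -⟩ := hS
  constructor
  · intro h
    have hw₁ : w 1 = 0 := by simpa using congrFun h 0
    have hF : w 0 * w 2 + (1 - w 0 ^ 2) * deriv Ut (w 0) = 0 := by simpa using congrFun h 1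
    have hw₂ : 0 ≤ w 2 := by simpa [hw₁] using h1
    rcases h0.eq_or_lt with h0 | h0
    · left
      have hw₂' : w 2 = 0 := by simpa [← h0] using hF
      ext i
      fin_cases i <;> simp [← h0, hw₁, hw₂']
    · right
      have hpos : 0 < w 0 := by linarith
      have hsq : 0 < w 0 ^ 2 - 1 := by nlinarith
      have hmul : (w 0 ^ 2 - 1) * deriv Ut (w 0) = w 0 * w 2 := by linarith
      refine ⟨w 0, h0, ?_, ?_⟩
      · exact nonneg_of_mul_nonneg_right (hmul ▸ mul_nonneg hpos.le hw₂) hsq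
      · have hw₂' : w 2 = (w 0 ^ 2 - 1) / w 0 * deriv Ut (w 0) := by
          rw [div_mul_eq_mul_div, hmul, mul_div_cancel_left₀ _ hpos.ne']
        ext i
        fin_cases i
        · simp
        · simpa using hw₁
        · simpa using hw₂'
  · rintro (rfl | ⟨ρ, hρ, -, rfl⟩)
    · ext i
      fin_cases i <;> simp
    · have hρ₀ : ρ ≠ 0 := by linarith
      ext i
      fin_cases i
      · simp
      · simp
        field_simp
        ring
      · simp
end

section
/- Let G_h be the group of matrices R_h(s) = [[1,0,0],[0, cosh s, sinh s],[0, sinh s, cosh s]], s ∈ ℝ, acting diagonally on ℝ³×ℝ³ by (x,y) ↦ (R_h(s)x, R_h(s)y). A polynomial p ∈ ℝ[x₁,x₂,x₃,y₁,y₂,y₃] is invariant under this action if and only if p belongs to the subalgebra generated by τ₁ = x₁, τ₂ = y₁, τ₃ = y₁²+y₂²−y₃², τ₄ = x₂y₂−x₃y₃, τ₅ = x₂²−x₃², τ₆ = x₃y₂−x₂y₃. Moreover the kernel of the algebra homomorphism ℝ[w₁,…,w₆] → ℝ[x,y] sending w_i to τ_i is the ideal generated by the single polynomial w₄² − w₆²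 − w₅(w₃ − w₂²). -/
open MvPolynomial

namespace MvPolynomial

variable {σ τ R : Type*} [CommRing R]

theorem eval_aeval_eq (z : τ → R) (g : σ → MvPolynomial τ R) (p : MvPolynomial σ R) :
    eval z (aeval g p) = eval (fun i => eval z (g i)) p := by
  induction p using MvPolynomial.induction_on with
  | C a => simp
  | add p q hp hq => simp only [map_add, hp, hq]
  | mul_X p i hp => simp only [map_mul, aeval_X, eval_X, hp]

theorem coeff_aeval_C_mul_X_s14 [Fintype σ] (c : σ → R) (p : MvPolynomial σ R) (m : σ →₀ ℕ) :
    coeff m (aeval (fun i => C (c i) * X i : σ → MvPolynomial σ R) p) =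
      (∏ i, c i ^ m i) * coeff m p := by
  classical
  induction p using MvPolynomial.induction_on' with
  | monomial u a =>
    have h : aeval (fun i => C (c i) * X i : σ → MvPolynomial σ R) (monomial u a) =
        monomial u ((∏ i, c i ^ u i) * a) := by
      rw [aeval_monomial, Finsupp.prod_fintype _ _ (by simp), monomial_eq (s := u),
        Finsupp.prod_fintype _ _ (by simp)]
      simp only [mul_pow, Finset.prod_mul_distrib, algebraMap_eq, map_mul, map_prod, map_pow]
      ring
    rw [h, coeff_monomial, coeff_monomial]
    split_ifs with h
    · rw [h]
    · simp
  | add p q hp hq => simp only [map_add, coeff_add, hp, hq, mul_add]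

end MvPolynomial

/-- The polynomial substitution expressing light-cone coordinates through the original ones. -/
noncomputable def lightCone : MvPolynomial (Fin 6) ℝ →ₐ[ℝ] MvPolynomial (Fin 6) ℝ :=
  aeval ![X 0, X 1 + X 2, X 1 - X 2, X 3, X 4 + X 5, X 4 - X 5]

/-- The inverse substitution of `lightCone`. -/
noncomputable def lightConeInv : MvPolynomial (Fin 6) ℝ →ₐ[ℝ] MvPolynomial (Fin 6) ℝ :=
  aeval ![X 0, C (1 / 2) * (X 1 + X 2), C (1 / 2) * (X 1 - X 2), X 3,
    C (1 / 2) * (X 4 + X 5), C (1 / 2) * (X 4 - X 5)]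

theorem lightCone_lightConeInv (p : MvPolynomial (Fin 6) ℝ) :
    lightCone (lightConeInv p) = p := by
  refine MvPolynomial.funext fun z => ?_
  rw [lightCone, lightConeInv, eval_aeval_eq, eval_aeval_eq]
  congr 2
  funext i
  fin_cases i <;> simp <;> ring

/-- The invariants `τ₁, …, τ₆` of the hyperbolic rotation group. -/
def hyperbolicGenerators : Set (MvPolynomial (Fin 6) ℝ) :=
  {X 0, X 3, X 3 ^ 2 + X 4 ^ 2 - X 5 ^ 2, X 1 * X 4 - X 2 * X 5,
    X 1 ^ 2 - X 2 ^ 2, X 2 * X 4 - X 1 * X 5}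

/-- The action of the hyperbolic rotation `R_h(s)` on `ℝ³ × ℝ³`. -/
noncomputable def hyperbolicRotation (s : ℝ) (z : Fin 6 → ℝ) : Fin 6 → ℝ :=
  ![z 0, Real.cosh s * z 1 + Real.sinh s * z 2, Real.sinh s * z 1 + Real.cosh s * z 2,
    z 3, Real.cosh s * z 4 + Real.sinh s * z 5, Real.sinh s * z 4 + Real.cosh s * z 5]

theorem eval_hyperbolicRotation_of_mem_adjoin {p : MvPolynomial (Fin 6) ℝ}
    (hp : p ∈ Algebra.adjoin ℝ hyperbolicGenerators) (s : ℝ) (z : Fin 6 → ℝ) :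
    eval (hyperbolicRotation s z) p = eval z p := by
  have hs := Real.cosh_sq s
  induction hp using Algebra.adjoin_induction with
  | mem q hq =>
    simp only [hyperbolicGenerators, Set.mem_insert_iff, Set.mem_singleton_iff] at hq
    rcases hq with rfl | rfl | rfl | rfl | rfl | rfl <;>
      simp [hyperbolicRotation] <;> ring_nf <;> rw [hs] <;> ring
  | algebraMap r => simp
  | add p q _ _ hp hq => simp [hp, hq]
  | mul p q _ _ hp hq => simp [hp, hq]

theorem balanced_of_mem_support_lightConeInv {p : MvPolynomial (Fin 6) ℝ}
    (hp : ∀ s z, eval (hyperbolicRotation s z) p = eval z p) {m : Fin 6 →₀ ℕ}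
    (hm : m ∈ (lightConeInv p).support) : m 1 + m 4 = m 2 + m 5 := by
  let c : Fin 6 → ℝ := ![1, 2, 1 / 2, 1, 2, 1 / 2]
  have hq : aeval (fun i => C (c i) * X i : Fin 6 → MvPolynomial (Fin 6) ℝ) (lightConeInv p) =
      lightConeInv p := by
    refine MvPolynomial.funext fun z => ?_
    rw [lightConeInv, eval_aeval_eq, eval_aeval_eq, eval_aeval_eq]
    refine Eq.trans ?_ (hp (Real.log 2) _)
    congr 2
    funext i
    fin_cases i <;>
      simp [c, hyperbolicRotation, Real.cosh_log, Real.sinh_log] <;> ring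
  have hcoeff := congrArg (coeff m) hq
  rw [coeff_aeval_C_mul_X_s14, mul_eq_right₀ (mem_support_iff.mp hm)] at hcoeff
  simp only [c, Fin.prod_univ_six, Matrix.cons_val, one_pow, one_div, inv_pow] at hcoeff
  have hpow : (2 : ℝ) ^ (m 1 + m 4) = 2 ^ (m 2 + m 5) := by
    rw [pow_add, pow_add]
    field_simp at hcoeff
    linarith
  exact pow_right_injective₀ (by norm_num) (by norm_num) hpow

theorem lightCone_monomial_mem_adjoin {m : Fin 6 →₀ ℕ} (hm : m 1 + m 4 = m 2 + m 5) (a : ℝ) :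
    lightCone (monomial m a) ∈ Algebra.adjoin ℝ hyperbolicGenerators := by
  set A := Algebra.adjoin ℝ hyperbolicGenerators
  have hgen {q} (hq : q ∈ hyperbolicGenerators) : q ∈ A := Algebra.subset_adjoin hq
  have h1 : X 0 ∈ A := hgen (by simp [hyperbolicGenerators])
  have h2 : X 3 ∈ A := hgen (by simp [hyperbolicGenerators])
  have h3 : X 3 ^ 2 + X 4 ^ 2 - X 5 ^ 2 ∈ A := hgen (by simp [hyperbolicGenerators])
  have h4 : X 1 * X 4 - X 2 * X 5 ∈ A := hgen (by simp [hyperbolicGenerators])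
  have h5 : X 1 ^ 2 - X 2 ^ 2 ∈ A := hgen (by simp [hyperbolicGenerators])
  have h6 : X 2 * X 4 - X 1 * X 5 ∈ A := hgen (by simp [hyperbolicGenerators])
  have h12 : (X 1 + X 2) * (X 1 - X 2) ∈ A := by convert h5 using 1; ring
  have h45 : (X 4 + X 5) * (X 4 - X 5) ∈ A := by
    convert sub_mem h3 (pow_mem h2 2) using 1; ring
  have h15 : (X 1 + X 2) * (X 4 - X 5) ∈ A := by convert add_mem h4 h6 using 1; ring
  have h42 : (X 4 + X 5) * (X 1 - X 2) ∈ A := by convert sub_mem h4 h6 using 1; ring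
  have heq : lightCone (monomial m a) = C a * (X 0 ^ m 0 * (X 1 + X 2) ^ m 1 * (X 1 - X 2) ^ m 2 *
      X 3 ^ m 3 * (X 4 + X 5) ^ m 4 * (X 4 - X 5) ^ m 5) := by
    rw [lightCone, aeval_monomial, Finsupp.prod_fintype _ _ (by simp)]
    simp [Fin.prod_univ_six, algebraMap_eq]
  have hC : C a ∈ A := A.algebraMap_mem a
  rw [heq]
  rcases le_total (m 1) (m 2) with h | h
  · obtain ⟨k, hk⟩ := Nat.exists_eq_add_of_le h
    have h4' : m 4 = k + m 5 := by omega
    convert mul_mem hC (mul_mem (mul_mem (mul_mem (mul_mem (pow_mem h1 (m 0)) (pow_mem h2 (m 3)))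
      (pow_mem h12 (m 1))) (pow_mem h42 k)) (pow_mem h45 (m 5))) using 1
    rw [h4', hk]
    simp only [mul_pow, pow_add]
    ring
  · obtain ⟨k, hk⟩ := Nat.exists_eq_add_of_le h
    have h5' : m 5 = k + m 4 := by omega
    convert mul_mem hC (mul_mem (mul_mem (mul_mem (mul_mem (pow_mem h1 (m 0)) (pow_mem h2 (m 3)))
      (pow_mem h12 (m 2))) (pow_mem h15 k)) (pow_mem h45 (m 4))) using 1
    rw [h5', hk]
    simp only [mul_pow, pow_add]
    ring

theorem mem_adjoin_of_eval_hyperbolicRotation {p : MvPolynomial (Fin 6) ℝ}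
    (hp : ∀ s z, eval (hyperbolicRotation s z) p = eval z p) :
    p ∈ Algebra.adjoin ℝ hyperbolicGenerators := by
  rw [← lightCone_lightConeInv p, (lightConeInv p).as_sum, map_sum]
  exact sum_mem fun m hm =>
    lightCone_monomial_mem_adjoin (balanced_of_mem_support_lightConeInv hp hm) _

/-- The relation `w₄² − w₆² − w₅(w₃ − w₂²)`. -/
noncomputable def hyperbolicRelation : MvPolynomial (Fin 6) ℝ :=
  X 3 ^ 2 - X 5 ^ 2 - X 4 * (X 2 - X 1 ^ 2)

theorem exists_linear_form_mod_hyperbolicRelation (f : MvPolynomial (Fin 6) ℝ) :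
    ∃ f₀ f₁ : MvPolynomial (Fin 5) ℝ,
      f - (rename Fin.castSucc f₀ + rename Fin.castSucc f₁ * X 5) ∈
        Ideal.span {hyperbolicRelation} := by
  simp only [Ideal.mem_span_singleton']
  induction f using MvPolynomial.induction_on with
  | C a => exact ⟨C a, 0, 0, by simp⟩
  | add p q hp hq =>
    obtain ⟨p₀, p₁, u, hu⟩ := hp
    obtain ⟨q₀, q₁, v, hv⟩ := hq
    refine ⟨p₀ + q₀, p₁ + q₁, u + v, ?_⟩
    simp only [map_add]
    linear_combination hu + hv
  | mul_X p i hp =>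
    obtain ⟨p₀, p₁, u, hu⟩ := hp
    induction i using Fin.lastCases with
    | cast j =>
      refine ⟨p₀ * X j, p₁ * X j, u * X j.castSucc, ?_⟩
      simp only [map_mul, rename_X]
      linear_combination X j.castSucc * hu
    | last =>
      refine ⟨p₁ * (X 3 ^ 2 - X 4 * (X 2 - X 1 ^ 2)), p₀,
        u * X 5 - rename Fin.castSucc p₁, ?_⟩
      have h (j : Fin 5) : rename Fin.castSucc (X j : MvPolynomial (Fin 5) ℝ) = X j.castSucc :=
        rename_X _ _
      simp only [map_mul, map_sub, map_pow, h, Fin.reduceCastSucc, Fin.reduceLast]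
      unfold hyperbolicRelation at hu ⊢
      linear_combination X 5 * hu

/-- The algebra homomorphism sending `wᵢ` to `τᵢ`. -/
noncomputable def hyperbolicMap : MvPolynomial (Fin 6) ℝ →ₐ[ℝ] MvPolynomial (Fin 6) ℝ :=
  aeval ![X 0, X 3, X 3 ^ 2 + X 4 ^ 2 - X 5 ^ 2, X 1 * X 4 - X 2 * X 5,
    X 1 ^ 2 - X 2 ^ 2, X 2 * X 4 - X 1 * X 5]

theorem hyperbolicMap_hyperbolicRelation : hyperbolicMap hyperbolicRelation = 0 := by
  simp only [hyperbolicMap, hyperbolicRelation, map_sub, map_mul, map_pow, aeval_X,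
    Matrix.cons_val]
  ring

theorem eval_eq_zero_of_hyperbolicMap_eq_zero {f : MvPolynomial (Fin 6) ℝ}
    (hf : hyperbolicMap f = 0) {w : Fin 6 → ℝ} (h4 : w 4 ≠ 0)
    (hw : w 3 ^ 2 - w 5 ^ 2 = w 4 * (w 2 - w 1 ^ 2)) : eval w f = 0 := by
  let c := w 3 - w 5
  let d := (w 3 + w 5) / w 4
  have hcd : c * d = w 2 - w 1 ^ 2 := by
    simp only [c, d]
    field_simp
    linear_combination hw
  have hd : w 4 * d = w 3 + w 5 := by simp only [d]; field_simp
  have h := congrArg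
    (eval ![w 0, (w 4 + 1) / 2, (w 4 - 1) / 2, w 1, (c + d) / 2, (c - d) / 2]) hf
  rw [hyperbolicMap, eval_aeval_eq, map_zero] at h
  rw [← h]
  congr 2
  funext i
  fin_cases i <;> simp
  · linear_combination -hcd
  · simp only [c] at *; linear_combination -hd / 2
  · ring
  · simp only [c] at *; linear_combination -hd / 2

theorem ker_hyperbolicMap :
    RingHom.ker hyperbolicMap = Ideal.span {hyperbolicRelation} := by
  refine le_antisymm (fun f hf => ?_) ?_
  · obtain ⟨f₀, f₁, h⟩ := exists_linear_form_mod_hyperbolicRelation f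
    have hle : Ideal.span {hyperbolicRelation} ≤ RingHom.ker hyperbolicMap := by
      rw [Ideal.span_singleton_le_iff_mem]
      exact hyperbolicMap_hyperbolicRelation
    have hg : hyperbolicMap (rename Fin.castSucc f₀ + rename Fin.castSucc f₁ * X 5) = 0 := by
      have := sub_mem hf (hle h)
      rwa [sub_sub_cancel] at this
    let s : Fin 5 → Set ℝ := ![Set.univ, Set.univ, Set.Iio 0, Set.univ, Set.Ioi 0]
    have hs : ∀ i, (s i).Infinite := by
      intro i
      fin_cases i
      exacts [Set.infinite_univ, Set.infinite_univ, Set.Iio_infinite 0, Set.infinite_univ,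
        Set.Ioi_infinite 0]
    have hv : ∀ v ∈ Set.pi Set.univ s, eval v f₀ = 0 ∧ eval v f₁ = 0 := by
      intro v hv
      have hv2 : v 2 < 0 := hv 2 trivial
      have hv4 : 0 < v 4 := hv 4 trivial
      have hpos : 0 < v 3 ^ 2 - v 4 * (v 2 - v 1 ^ 2) := by
        nlinarith [sq_nonneg (v 3), mul_pos hv4 (neg_pos.2 hv2),
          mul_nonneg hv4.le (sq_nonneg (v 1))]
      have hr := Real.sq_sqrt hpos.le
      have hr' := Real.sqrt_pos.2 hpos
      set r := √(v 3 ^ 2 - v 4 * (v 2 - v 1 ^ 2))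
      have key (t : ℝ) (ht : t ^ 2 = r ^ 2) : eval v f₀ + eval v f₁ * t = 0 := by
        have h0 := eval_eq_zero_of_hyperbolicMap_eq_zero hg
          (w := Fin.snoc (α := fun _ => ℝ) v t) (show v 4 ≠ 0 from hv4.ne')
          (show v 3 ^ 2 - t ^ 2 = v 4 * (v 2 - v 1 ^ 2) by rw [ht, hr]; ring)
        have hcomp : (Fin.snoc (α := fun _ => ℝ) v t : Fin 6 → ℝ) ∘ Fin.castSucc = v := by
          funext i
          simp
        have hlast : (Fin.snoc (α := fun _ => ℝ) v t : Fin 6 → ℝ) 5 = t :=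
          Fin.snoc_last (α := fun _ => ℝ) t v
        simpa only [map_add, map_mul, eval_rename, hcomp, eval_X, hlast] using h0
      have hplus := key r rfl
      have hminus := key (-r) (by ring)
      have h1 : eval v f₁ * r = 0 := by linarith
      have h1' : eval v f₁ = 0 := (mul_eq_zero.1 h1).resolve_right hr'.ne'
      exact ⟨by simpa [h1'] using hplus, h1'⟩
    have h₀ : f₀ = 0 := funext_set s hs fun v h => by simpa using (hv v h).1
    have h₁ : f₁ = 0 := funext_set s hs fun v h => by simpa using (hv v h).2
    simpa [h₀, h₁] using h
  · rw [Ideal.span_singleton_le_iff_mem]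
    exact hyperbolicMap_hyperbolicRelation

/-- invariants of the hyperbolic rotation group acting diagonally on
`ℝ³ × ℝ³` (coordinates `x = (z₀,z₁,z₂)`, `y = (z₃,z₄,z₅)`).  A polynomial is invariant
iff it lies in the subalgebra generated by `τ₁ = x₁, τ₂ = y₁, τ₃ = y₁²+y₂²−y₃²,
τ₄ = x₂y₂−x₃y₃, τ₅ = x₂²−x₃², τ₆ = x₃y₂−x₂y₃`, and the ideal of relations between the
`τᵢ` is generated by `w₄² − w₆² − w₅(w₃ − w₂²)`. -/
theorem hyperbolic_invariants :
    (∀ p : MvPolynomial (Fin 6) ℝ,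
      (∀ s : ℝ, ∀ z : Fin 6 → ℝ,
        eval (![z 0,
                Real.cosh s * z 1 + Real.sinh s * z 2,
                Real.sinh s * z 1 + Real.cosh s * z 2,
                z 3,
                Real.cosh s * z 4 + Real.sinh s * z 5,
                Real.sinh s * z 4 + Real.cosh s * z 5] : Fin 6 → ℝ) p = eval z p)
        ↔ p ∈ Algebra.adjoin ℝ
            ({X 0, X 3, X 3 ^ 2 + X 4 ^ 2 - X 5 ^ 2, X 1 * X 4 - X 2 * X 5,
              X 1 ^ 2 - X 2 ^ 2, X 2 * X 4 - X 1 * X 5} :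
              Set (MvPolynomial (Fin 6) ℝ))) ∧
    RingHom.ker (aeval
        (![X 0, X 3, X 3 ^ 2 + X 4 ^ 2 - X 5 ^ 2, X 1 * X 4 - X 2 * X 5,
           X 1 ^ 2 - X 2 ^ 2, X 2 * X 4 - X 1 * X 5] :
          Fin 6 → MvPolynomial (Fin 6) ℝ) :
        MvPolynomial (Fin 6) ℝ →ₐ[ℝ] MvPolynomial (Fin 6) ℝ)
      = Ideal.span {X 3 ^ 2 - X 5 ^ 2 - X 4 * (X 2 - X 1 ^ 2)} := by
  exact ⟨fun _ => ⟨mem_adjoin_of_eval_hyperbolicRotation, eval_hyperbolicRotation_of_mem_adjoin⟩,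
    ker_hyperbolicMap⟩
end

section
/- Let Γ : ℝ³×ℝ³ → ℝ⁴ be the map Γ(x,y) = (τ₁, τ₂, τ₃, τ₆)(x,y) with τ₁ = x₁, τ₂ = y₁, τ₃ = y₁²+y₂²−y₃², τ₆ = x₃y₂−x₂y₃. Then the image of the tangent bundle Tℍ² under Γ is exactly the set Y = {w = (w₁,w₂,w₃,w₄) ∈ ℝ⁴ : w₄² = (w₁²+1)w₃ − w₂²}. -/
noncomputable section

/-- the image of `Tℍ²` under `Γ = (τ₁,τ₂,τ₃,τ₆)` is exactly the variety
`Y = {w : w₄² = (w₁²+1)w₃ − w₂²}`. -/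
theorem hyperbolic_hilbert_map_image :
    (fun z : V3 × V3 =>
        (![z.1 0, z.2 0, (z.2 0) ^ 2 + (z.2 1) ^ 2 - (z.2 2) ^ 2,
           z.1 2 * z.2 1 - z.1 1 * z.2 2] : Fin 4 → ℝ)) '' TH2
      = {w : Fin 4 → ℝ | (w 3) ^ 2 = ((w 0) ^ 2 + 1) * w 2 - (w 1) ^ 2} := by
  ext w
  constructor
  · rintro ⟨⟨x, y⟩, ⟨hxx, -, hxy⟩, rfl⟩
    simp only [Lprod] at hxx hxy
    simp only [Set.mem_ofPred_eq, Matrix.cons_val]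
    linear_combination (x 1 * y 1 - x 2 * y 2 - x 0 * y 0) * hxy
      - ((y 1) ^ 2 - (y 2) ^ 2) * hxx
  · intro hw
    simp only [Set.mem_ofPred_eq] at hw
    obtain ⟨s, hs, hs2⟩ : ∃ s : ℝ, 0 < s ∧ s ^ 2 = (w 0) ^ 2 + 1 :=
      ⟨√((w 0) ^ 2 + 1), by positivity, Real.sq_sqrt (by positivity)⟩
    refine ⟨(![w 0, 0, s], ![w 1, w 3 / s, w 0 * w 1 / s]), ⟨?_, ?_, ?_⟩, ?_⟩
    · simp only [Lprod, Matrix.cons_val]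
      linear_combination -hs2
    · simpa using hs
    · simp only [Lprod, Matrix.cons_val]
      field_simp
      ring
    · ext i
      fin_cases i
      · simp
      · simp
      · simp only [Fin.reduceFinMk, Matrix.cons_val]
        field_simp
        linear_combination hw + ((w 1) ^ 2 - w 2) * hs2
      · simp only [Fin.reduceFinMk, Matrix.cons_val]
        field_simp
        ring
end
end

section
/- Let Γ̃ : ℝ³×ℝ³ → ℝ³ be the map Γ̃(x,y) = (x₁, y₁, y₁²+y₂²−y₃²). Then a point w = (w₁,w₂,w₃) ∈ ℝ³ lies in Γ̃(Tℍ²) if and only if (w₁²+1)w₃ − w₂² ≥ 0. -/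
noncomputable section

/-- For a tangent vector `y` at `x`, the discriminant is the square of `x₃y₂ − x₂y₃`. -/
theorem discriminant_eq_sq {x y : V3} (hx : Lprod x x = -1) (hxy : Lprod x y = 0) :
    (x 0 ^ 2 + 1) * (y 0 ^ 2 + y 1 ^ 2 - y 2 ^ 2) - y 0 ^ 2 =
      (x 2 * y 1 - x 1 * y 2) ^ 2 := by
  unfold Lprod at hx hxy
  linear_combination (y 1 ^ 2 - y 2 ^ 2) * hx + (x 0 * y 0 + x 2 * y 2 - x 1 * y 1) * hxy

/-- `w ∈ Γ̃(Tℍ²)` for `Γ̃ = (x₁, y₁, y₁²+y₂²−y₃²)` iff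
`(w₁²+1)w₃ − w₂² ≥ 0`. -/
theorem hyperbolic_reduced_image (w : Fin 3 → ℝ) :
    w ∈ (fun z : V3 × V3 =>
        (![z.1 0, z.2 0, (z.2 0) ^ 2 + (z.2 1) ^ 2 - (z.2 2) ^ 2] : Fin 3 → ℝ)) '' TH2
      ↔ 0 ≤ ((w 0) ^ 2 + 1) * w 2 - (w 1) ^ 2 := by
  constructor
  · rintro ⟨⟨x, y⟩, ⟨hx, -, hxy⟩, rfl⟩
    have h := discriminant_eq_sq hx hxy
    simpa [h] using sq_nonneg (x 2 * y 1 - x 1 * y 2)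
  · intro h
    have hpos : 0 < w 0 ^ 2 + 1 := by positivity
    obtain ⟨q, hq, hq2⟩ : ∃ q : ℝ, 0 < q ∧ q ^ 2 = w 0 ^ 2 + 1 :=
      ⟨_, Real.sqrt_pos.2 hpos, Real.sq_sqrt hpos.le⟩
    obtain ⟨s, hs⟩ : ∃ s : ℝ, s ^ 2 = (w 0 ^ 2 + 1) * w 2 - w 1 ^ 2 :=
      ⟨_, Real.sq_sqrt h⟩
    refine ⟨(![w 0, 0, q], ![w 1, s / q, w 0 * w 1 / q]), ⟨?_, ?_, ?_⟩, ?_⟩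
    · simp only [Lprod, Matrix.cons_val]
      linear_combination -hq2
    · simpa using hq
    · simp only [Lprod, Matrix.cons_val]
      field_simp
      ring
    · have hw : w 1 ^ 2 + (s / q) ^ 2 - (w 0 * w 1 / q) ^ 2 = w 2 := by
        field_simp
        linear_combination hs + (w 1 ^ 2 - w 2) * hq2
      ext i
      fin_cases i
      · simp
      · simp
      · simpa using hw
end
end

section
/- Let G_p be the group of matrices R_p(s) = [[1, −s, s],[s, 1−s²/2, s²/2],[s, −s²/2, 1+s²/2]], s ∈ ℝ, acting diagonally on ℝ³×ℝ³ by (x,y) ↦ (R_p(s)x, R_p(s)y). A polynomial p ∈ ℝ[x₁,x₂,x₃,y₁,y₂,y₃] is invariant under this action if and only if p belongs to the subalgebra generated by ζ₁ = x₂−x₃, ζ₂ = y₂−y₃, ζ₃ = y₁²+y₂²−y₃², ζ₄ = x₁y₁+2x₂y₂−x₂y₃−x₃y₂, ζ₅ = x₁²−2x₂x₃+2x₂², ζ₆ = x₁(y₂−y₃)+y₁(x₃−x₂); and these generators satisfy the relation ζ₁²ζ₂² + ζ₁²ζ₃ − 2ζ₁ζ₂ζ₄ + ζ₂²ζ₅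 − ζ₆² = 0. -/
open MvPolynomial

namespace ParabolicInvariants

/-- The subalgebra generated by the six basic invariants. -/
noncomputable abbrev basicAlgebra : Subalgebra ℝ (MvPolynomial (Fin 6) ℝ) :=
  Algebra.adjoin ℝ
    ({X 1 - X 2, X 4 - X 5, X 3 ^ 2 + X 4 ^ 2 - X 5 ^ 2,
      X 0 * X 3 + 2 * X 1 * X 4 - X 1 * X 5 - X 2 * X 4,
      X 0 ^ 2 - 2 * X 1 * X 2 + 2 * X 1 ^ 2,
      X 0 * (X 4 - X 5) + X 3 * (X 2 - X 1)} :
      Set (MvPolynomial (Fin 6) ℝ))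

/-- The diagonal action of the parabolic rotation with parameter `s`. -/
noncomputable abbrev rotate (s : ℝ) (z : Fin 6 → ℝ) : Fin 6 → ℝ :=
  ![z 0 - s * z 1 + s * z 2,
    s * z 0 + (1 - s ^ 2 / 2) * z 1 + (s ^ 2 / 2) * z 2,
    s * z 0 - (s ^ 2 / 2) * z 1 + (1 + s ^ 2 / 2) * z 2,
    z 3 - s * z 4 + s * z 5,
    s * z 3 + (1 - s ^ 2 / 2) * z 4 + (s ^ 2 / 2) * z 5,
    s * z 3 - (s ^ 2 / 2) * z 4 + (1 + s ^ 2 / 2) * z 5]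

lemma zeta1_mem : (X 1 - X 2 : MvPolynomial (Fin 6) ℝ) ∈ basicAlgebra :=
  Algebra.subset_adjoin (by simp)

lemma zeta2_mem : (X 4 - X 5 : MvPolynomial (Fin 6) ℝ) ∈ basicAlgebra :=
  Algebra.subset_adjoin (by simp)

lemma zeta3_mem :
    (X 3 ^ 2 + X 4 ^ 2 - X 5 ^ 2 : MvPolynomial (Fin 6) ℝ) ∈ basicAlgebra :=
  Algebra.subset_adjoin (by simp)

lemma zeta4_mem :
    (X 0 * X 3 + 2 * X 1 * X 4 - X 1 * X 5 - X 2 * X 4 : MvPolynomial (Fin 6) ℝ)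
      ∈ basicAlgebra :=
  Algebra.subset_adjoin (by simp)

lemma zeta5_mem :
    (X 0 ^ 2 - 2 * X 1 * X 2 + 2 * X 1 ^ 2 : MvPolynomial (Fin 6) ℝ) ∈ basicAlgebra :=
  Algebra.subset_adjoin (by simp)

lemma zeta6_mem :
    (X 0 * (X 4 - X 5) + X 3 * (X 2 - X 1) : MvPolynomial (Fin 6) ℝ) ∈ basicAlgebra :=
  Algebra.subset_adjoin (by simp)

lemma eval_rotate_of_mem {p : MvPolynomial (Fin 6) ℝ} (hp : p ∈ basicAlgebra)
    (s : ℝ) (z : Fin 6 → ℝ) : eval (rotate s z) p = eval z p := by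
  induction hp using Algebra.adjoin_induction with
  | mem q hq =>
    simp only [Set.mem_insert_iff, Set.mem_singleton_iff] at hq
    rcases hq with rfl | rfl | rfl | rfl | rfl | rfl <;> simp <;> ring
  | algebraMap r => simp [algebraMap_eq]
  | add q r _ _ hq hr => simp only [map_add, hq, hr]
  | mul q r _ _ hq hr => simp only [map_mul, hq, hr]

/-- If the coordinates of a point, multiplied by `d`, are values of elements of a subalgebra
containing `d`, then so is the value of any polynomial, up to a power of `d`. -/
lemma exists_pow_mul_eval_eq {σ τ : Type*} (A : Subalgebra ℝ (MvPolynomial σ ℝ))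
    {d : MvPolynomial σ ℝ} (hd : d ∈ A) (w : (σ → ℝ) → τ → ℝ)
    (hw : ∀ i, ∃ c ∈ A, ∀ z, eval z d ≠ 0 → eval z d * w z i = eval z c)
    (p : MvPolynomial τ ℝ) :
    ∃ N : ℕ, ∃ r ∈ A, ∀ z, eval z d ≠ 0 → eval z d ^ N * eval (w z) p = eval z r := by
  induction p using MvPolynomial.induction_on with
  | C c =>
    exact ⟨0, C c, A.algebraMap_mem c, fun z _ => by simp⟩
  | add p q hp hq =>
    obtain ⟨M, r, hr, hp⟩ := hp
    obtain ⟨N, t, ht, hq⟩ := hq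
    refine ⟨M + N, d ^ N * r + d ^ M * t,
      add_mem (mul_mem (pow_mem hd _) hr) (mul_mem (pow_mem hd _) ht), fun z hz => ?_⟩
    simp only [map_add, map_mul, map_pow, ← hp z hz, ← hq z hz]
    ring
  | mul_X p i hp =>
    obtain ⟨N, r, hr, hp⟩ := hp
    obtain ⟨c, hc, hi⟩ := hw i
    refine ⟨N + 1, r * c, mul_mem hr hc, fun z hz => ?_⟩
    simp only [map_mul, eval_X, ← hp z hz, ← hi z hz]
    ring

/-- Rotating by the slice parameter `x₁ / (x₂ - x₃)` expresses an invariant through the basic ones,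
up to a power of `x₂ - x₃`. -/
lemma exists_pow_mul_mem {p : MvPolynomial (Fin 6) ℝ}
    (hp : ∀ s z, eval (rotate s z) p = eval z p) :
    ∃ N : ℕ, (X 1 - X 2) ^ N * p ∈ basicAlgebra := by
  have hd : ((X 1 - X 2) ^ 2 : MvPolynomial (Fin 6) ℝ) ∈ basicAlgebra := pow_mem zeta1_mem 2
  have hhalf : (C (1 / 2) : MvPolynomial (Fin 6) ℝ) ∈ basicAlgebra :=
    basicAlgebra.algebraMap_mem _
  have hv := mul_mem hhalf (mul_mem zeta1_mem zeta5_mem)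
  have hw := mul_mem hhalf (sub_mem (mul_mem (add_mem zeta1_mem zeta1_mem) zeta4_mem)
    (mul_mem zeta2_mem zeta5_mem))
  obtain ⟨N, r, hr, h⟩ := exists_pow_mul_eval_eq basicAlgebra hd
    (fun z => rotate (z 0 / (z 1 - z 2)) z) (fun i => by
      fin_cases i
      · refine ⟨0, zero_mem _, fun z hz => ?_⟩
        have hz' : z 1 - z 2 ≠ 0 := by simpa using hz
        have hslice : z 0 - z 0 / (z 1 - z 2) * z 1 + z 0 / (z 1 - z 2) * z 2 = 0 := by
          field_simp
          ring
        simp [hslice]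
      · refine ⟨_, hv, fun z hz => ?_⟩
        have hz' : z 1 - z 2 ≠ 0 := by simpa using hz
        simp
        field_simp
        ring
      · refine ⟨_, sub_mem hv (pow_mem zeta1_mem 3), fun z hz => ?_⟩
        have hz' : z 1 - z 2 ≠ 0 := by simpa using hz
        simp
        field_simp
        ring
      · refine ⟨_, neg_mem (mul_mem zeta1_mem zeta6_mem), fun z hz => ?_⟩
        have hz' : z 1 - z 2 ≠ 0 := by simpa using hz
        simp
        field_simp
        ring
      · refine ⟨_, hw, fun z hz => ?_⟩
        have hz' : z 1 - z 2 ≠ 0 := by simpa using hz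
        simp
        field_simp
        ring
      · refine ⟨_, sub_mem hw (mul_mem hd zeta2_mem), fun z hz => ?_⟩
        have hz' : z 1 - z 2 ≠ 0 := by simpa using hz
        simp
        field_simp
        ring) p
  refine ⟨2 * N + 1, ?_⟩
  convert mul_mem zeta1_mem hr using 1
  refine MvPolynomial.funext fun z => ?_
  by_cases hz : z 1 - z 2 = 0
  · simp [hz]
  · have := h z (by simpa using hz)
    rw [hp] at this
    rw [map_mul _ _ r, ← this]
    simp only [map_mul, map_pow, pow_succ', pow_mul]
    ring

/-- Substitution of `ζ₂, ζ₃, ζ₄, ζ₅`, which stay algebraically independent modulo `ζ₁`. -/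
noncomputable abbrev subst : MvPolynomial (Fin 4) ℝ →ₐ[ℝ] MvPolynomial (Fin 6) ℝ :=
  aeval ![X 4 - X 5, X 3 ^ 2 + X 4 ^ 2 - X 5 ^ 2,
    X 0 * X 3 + 2 * X 1 * X 4 - X 1 * X 5 - X 2 * X 4,
    X 0 ^ 2 - 2 * X 1 * X 2 + 2 * X 1 ^ 2]

lemma subst_mem (α : MvPolynomial (Fin 4) ℝ) : subst α ∈ basicAlgebra := by
  induction α using MvPolynomial.induction_on with
  | C c => simpa using basicAlgebra.algebraMap_mem c
  | add p q hp hq => simpa only [map_add] using add_mem hp hq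
  | mul_X p i hp =>
    rw [map_mul]
    refine mul_mem hp ?_
    rw [aeval_X]
    fin_cases i
    exacts [zeta2_mem, zeta3_mem, zeta4_mem, zeta5_mem]

/-- Modulo `ζ₁`, the basic algebra is spanned by `1` and `ζ₆` over the polynomials in
`ζ₂, ζ₃, ζ₄, ζ₅`. -/
lemma exists_normal_form {p : MvPolynomial (Fin 6) ℝ} (hp : p ∈ basicAlgebra) :
    ∃ α β : MvPolynomial (Fin 4) ℝ, ∃ r ∈ basicAlgebra,
      p = subst α + (X 0 * (X 4 - X 5) + X 3 * (X 2 - X 1)) * subst β + (X 1 - X 2) * r := by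
  induction hp using Algebra.adjoin_induction with
  | mem q hq =>
    simp only [Set.mem_insert_iff, Set.mem_singleton_iff] at hq
    rcases hq with rfl | rfl | rfl | rfl | rfl | rfl
    · exact ⟨0, 0, 1, one_mem _, by simp⟩
    · exact ⟨X 0, 0, 0, zero_mem _, by simp⟩
    · exact ⟨X 1, 0, 0, zero_mem _, by simp⟩
    · exact ⟨X 2, 0, 0, zero_mem _, by simp⟩
    · exact ⟨X 3, 0, 0, zero_mem _, by simp⟩
    · exact ⟨0, 1, 0, zero_mem _, by simp⟩
  | algebraMap c => exact ⟨C c, 0, 0, zero_mem _, by simp [algebraMap_eq]⟩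
  | add q q' _ _ hq hq' =>
    obtain ⟨α, β, r, hr, rfl⟩ := hq
    obtain ⟨α', β', r', hr', rfl⟩ := hq'
    exact ⟨α + α', β + β', r + r', add_mem hr hr', by simp only [map_add]; ring⟩
  | mul q q' _ hmem hq hq' =>
    obtain ⟨α, β, r, hr, rfl⟩ := hq
    obtain ⟨α', β', r', hr', hq'⟩ := hq'
    have hsq := mul_mem (mul_mem (subst_mem β) (subst_mem β'))
      (sub_mem (mul_mem zeta1_mem (add_mem (mul_mem zeta2_mem zeta2_mem) zeta3_mem))
        (mul_mem (add_mem zeta2_mem zeta2_mem) zeta4_mem))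
    have hcross := mul_mem (add_mem (subst_mem α) (mul_mem zeta6_mem (subst_mem β))) hr'
    refine ⟨α * α' + X 0 ^ 2 * X 3 * (β * β'), α * β' + β * α', _,
      add_mem hsq (add_mem hcross (mul_mem hr hmem)), ?_⟩
    have h0 : subst (X 0) = X 4 - X 5 := by simp
    have h3 : subst (X 3) = X 0 ^ 2 - 2 * X 1 * X 2 + 2 * X 1 ^ 2 := by simp
    rw [hq']
    simp only [map_add, map_mul, map_pow, h0, h3]
    ring

/-- No nontrivial normal form vanishes on the hyperplane `ζ₁ = 0`. -/
lemma eq_zero_of_zeta1_dvd {α β : MvPolynomial (Fin 4) ℝ}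
    (h : X 1 - X 2 ∣ subst α + (X 0 * (X 4 - X 5) + X 3 * (X 2 - X 1)) * subst β) :
    α = 0 ∧ β = 0 := by
  obtain ⟨e, he⟩ := h
  have key : ∀ t : Fin 4 → ℝ, (∀ i, 0 < t i) → ∀ u : ℝ, u ^ 2 = t 3 →
      eval t α + u * t 0 * eval t β = 0 := by
    intro t ht u hu
    have h0 : t 0 ≠ 0 := (ht 0).ne'
    let z : Fin 6 → ℝ := ![u, t 2 / t 0, t 2 / t 0, 0, (t 1 + t 0 ^ 2) / (2 * t 0),
      (t 1 + t 0 ^ 2) / (2 * t 0) - t 0]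
    have hsub : ∀ γ : MvPolynomial (Fin 4) ℝ, eval z (subst γ) = eval t γ := by
      intro γ
      induction γ using MvPolynomial.induction_on with
      | C c => simp
      | add p q hp hq => simp only [map_add, hp, hq]
      | mul_X p i hp =>
        rw [map_mul, map_mul, hp, map_mul, aeval_X, eval_X]
        congr 1
        fin_cases i
        · simp [z]
        · simp [z]
          field_simp
          ring
        · simp [z]
          field_simp
          ring
        · simp [z]
          linear_combination hu
    have := congrArg (eval z) he
    rw [map_add, map_mul, hsub, hsub] at this
    simpa [z] using this
  have hpos : ∀ t : Fin 4 → ℝ, (∀ i, 0 < t i) → eval t α = 0 ∧ eval t β = 0 := by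
    intro t ht
    have hs : 0 < √(t 3) := Real.sqrt_pos.mpr (ht 3)
    have h1 := key t ht (√(t 3)) (Real.sq_sqrt (ht 3).le)
    have h2 := key t ht (-√(t 3)) (by rw [neg_sq, Real.sq_sqrt (ht 3).le])
    refine ⟨by linear_combination (h1 + h2) / 2, ?_⟩
    have h3 : √(t 3) * t 0 * eval t β = 0 := by linear_combination (h1 - h2) / 2
    exact (mul_eq_zero.mp h3).resolve_left (mul_pos hs (ht 0)).ne'
  constructor <;>
    refine funext_set (fun _ => Set.Ioi 0) (fun _ => Set.Ioi_infinite 0) fun t ht => ?_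
  · simpa using (hpos t fun i => ht i (Set.mem_univ i)).1
  · simpa using (hpos t fun i => ht i (Set.mem_univ i)).2

lemma mem_of_zeta1_mul_mem {p : MvPolynomial (Fin 6) ℝ}
    (hp : (X 1 - X 2) * p ∈ basicAlgebra) : p ∈ basicAlgebra := by
  obtain ⟨α, β, r, hr, h⟩ := exists_normal_form hp
  obtain ⟨rfl, rfl⟩ := eq_zero_of_zeta1_dvd (α := α) (β := β)
    ⟨p - r, by linear_combination -h⟩
  have hne : (X 1 - X 2 : MvPolynomial (Fin 6) ℝ) ≠ 0 :=
    sub_ne_zero.mpr fun hX => absurd (X_injective hX) (by decide)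
  have : p = r := mul_left_cancel₀ hne (by simpa using h)
  exact this ▸ hr

lemma mem_of_zeta1_pow_mul_mem {p : MvPolynomial (Fin 6) ℝ} (N : ℕ)
    (hp : (X 1 - X 2) ^ N * p ∈ basicAlgebra) : p ∈ basicAlgebra := by
  induction N with
  | zero => simpa using hp
  | succ N ih => exact ih (mem_of_zeta1_mul_mem (by rwa [← mul_assoc, ← pow_succ']))

end ParabolicInvariants

/-- invariants of the parabolic rotation group acting diagonally on
`ℝ³ × ℝ³` (coordinates `x = (z₀,z₁,z₂)`, `y = (z₃,z₄,z₅)`).  A polynomial is invariant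
iff it lies in the subalgebra generated by `ζ₁ = x₂−x₃, ζ₂ = y₂−y₃, ζ₃ = y₁²+y₂²−y₃²,
ζ₄ = x₁y₁+2x₂y₂−x₂y₃−x₃y₂, ζ₅ = x₁²−2x₂x₃+2x₂², ζ₆ = x₁(y₂−y₃)+y₁(x₃−x₂)`, and these
generators satisfy `ζ₁²ζ₂² + ζ₁²ζ₃ − 2ζ₁ζ₂ζ₄ + ζ₂²ζ₅ − ζ₆² = 0`. -/
theorem parabolic_invariants :
    (∀ p : MvPolynomial (Fin 6) ℝ,
      (∀ s : ℝ, ∀ z : Fin 6 → ℝ,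
        eval (![z 0 - s * z 1 + s * z 2,
                s * z 0 + (1 - s ^ 2 / 2) * z 1 + (s ^ 2 / 2) * z 2,
                s * z 0 - (s ^ 2 / 2) * z 1 + (1 + s ^ 2 / 2) * z 2,
                z 3 - s * z 4 + s * z 5,
                s * z 3 + (1 - s ^ 2 / 2) * z 4 + (s ^ 2 / 2) * z 5,
                s * z 3 - (s ^ 2 / 2) * z 4 + (1 + s ^ 2 / 2) * z 5] : Fin 6 → ℝ) p
          = eval z p)
        ↔ p ∈ Algebra.adjoin ℝ
            ({X 1 - X 2, X 4 - X 5, X 3 ^ 2 + X 4 ^ 2 - X 5 ^ 2,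
              X 0 * X 3 + 2 * X 1 * X 4 - X 1 * X 5 - X 2 * X 4,
              X 0 ^ 2 - 2 * X 1 * X 2 + 2 * X 1 ^ 2,
              X 0 * (X 4 - X 5) + X 3 * (X 2 - X 1)} :
              Set (MvPolynomial (Fin 6) ℝ))) ∧
    ((X 1 - X 2 : MvPolynomial (Fin 6) ℝ) ^ 2 * (X 4 - X 5) ^ 2
      + (X 1 - X 2) ^ 2 * (X 3 ^ 2 + X 4 ^ 2 - X 5 ^ 2)
      - 2 * (X 1 - X 2) * (X 4 - X 5)
          * (X 0 * X 3 + 2 * X 1 * X 4 - X 1 * X 5 - X 2 * X 4)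
      + (X 4 - X 5) ^ 2 * (X 0 ^ 2 - 2 * X 1 * X 2 + 2 * X 1 ^ 2)
      - (X 0 * (X 4 - X 5) + X 3 * (X 2 - X 1)) ^ 2 = 0) := by
  refine ⟨fun p => ⟨fun hp => ?_, fun hp s z => ParabolicInvariants.eval_rotate_of_mem hp s z⟩,
    by ring⟩
  obtain ⟨N, hN⟩ := ParabolicInvariants.exists_pow_mul_mem hp
  exact ParabolicInvariants.mem_of_zeta1_pow_mul_mem N hN
end

section
/- Let Γ : ℝ³×ℝ³ → ℝ⁴ be the map Γ(x,y) = (ζ₁, ζ₂, ζ₃, ζ₆)(x,y) with ζ₁ = x₂−x₃, ζ₂ = y₂−y₃, ζ₃ = y₁²+y₂²−y₃², ζ₆ = x₁(y₂−y₃)+y₁(x₃−x₂). Then the image of the tangent bundle Tℍ² under Γ is exactly the set {w = (w₁,w₂,w₃,w₄) ∈ ℝ⁴ : w₄² = w₁²w₃ − w₂² and w₁ < 0}. -/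
noncomputable section

/-- the image of `Tℍ²` under `Γ = (ζ₁,ζ₂,ζ₃,ζ₆)` is exactly
`{w : w₄² = w₁²w₃ − w₂² and w₁ < 0}`. -/
theorem parabolic_hilbert_map_image :
    (fun z : V3 × V3 =>
        (![z.1 1 - z.1 2, z.2 1 - z.2 2, (z.2 0) ^ 2 + (z.2 1) ^ 2 - (z.2 2) ^ 2,
           z.1 0 * (z.2 1 - z.2 2) + z.2 0 * (z.1 2 - z.1 1)] : Fin 4 → ℝ)) '' TH2
      = {w : Fin 4 → ℝ | (w 3) ^ 2 = (w 0) ^ 2 * w 2 - (w 1) ^ 2 ∧ w 0 < 0} := by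
  ext w
  constructor
  · rintro ⟨⟨x, y⟩, ⟨hx, hpos, hxy⟩, rfl⟩
    simp only [Lprod] at hx hpos hxy
    simp only [Set.mem_ofPred_eq, Matrix.cons_val]
    refine ⟨?_, ?_⟩
    · linear_combination (y 1 - y 2) ^ 2 * hx - 2 * (x 1 - x 2) * (y 1 - y 2) * hxy
    · by_contra! h
      nlinarith [sq_nonneg (x 0)]
  · rintro ⟨hw, hneg⟩
    have hne : w 0 ≠ 0 := hneg.ne
    refine ⟨(![0, (w 0 - 1 / w 0) / 2, (-1 / w 0 - w 0) / 2],
      ![-w 3 / w 0, (w 1 / w 0 ^ 2 + w 1) / 2, (w 1 / w 0 ^ 2 - w 1) / 2]), ⟨?_, ?_, ?_⟩, ?_⟩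
    · simp only [Lprod, Matrix.cons_val]
      field_simp
      ring
    · simp only [Matrix.cons_val]
      have : 0 < -1 / w 0 := div_pos_of_neg_of_neg (by norm_num) hneg
      linarith
    · simp only [Lprod, Matrix.cons_val]
      field_simp
      ring
    · ext i
      fin_cases i
      · simp
        ring
      · simp
        ring
      · simp
        field_simp
        linear_combination 4 * w 0 ^ 2 * hw
      · simp
        field_simp
        ring
end
end

section
/- Let (x,y) and (x̂,ŷ) be points of the tangent bundle Tℍ² such that ζ_i(x,y) = ζ_i(x̂,ŷ) for i ∈ {1,2,3,6}, where ζ₁ = x₂−x₃, ζ₂ = y₂−y₃, ζ₃ = y₁²+y₂²−y₃², ζ₆ = x₁(y₂−y₃)+y₁(x₃−x₂). Then there exists s ∈ ℝ such that x̂ = R_p(s)x and ŷ = R_p(s)y, where R_p(s) = [[1, −s, s],[s, 1−s²/2, s²/2],[s, −s²/2, 1+s²/2]]. In other words, the invariants ζ₁, ζ₂, ζ₃, ζ₆ separate the orbits of the parabolic group action on Tℍ². -/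
noncomputable section

/-- The parabolic rotation `R_p(s)` acting on `ℝ³`. -/
def Rp (s : ℝ) (u : V3) : V3 :=
  ![u 0 - s * u 1 + s * u 2,
    s * u 0 + (1 - s ^ 2 / 2) * u 1 + (s ^ 2 / 2) * u 2,
    s * u 0 - (s ^ 2 / 2) * u 1 + (1 + s ^ 2 / 2) * u 2]

/-- the invariants `ζ₁, ζ₂, ζ₃, ζ₆` separate the orbits of the parabolic
group action on `Tℍ²`: two points of `Tℍ²` with the same values of the invariants lie on
the same `G_p`-orbit. -/
theorem parabolic_invariants_separate_orbits
    (z zh : V3 × V3) (hz : z ∈ TH2) (hzh : zh ∈ TH2)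
    (e1 : z.1 1 - z.1 2 = zh.1 1 - zh.1 2)
    (e2 : z.2 1 - z.2 2 = zh.2 1 - zh.2 2)
    (e3 : (z.2 0) ^ 2 + (z.2 1) ^ 2 - (z.2 2) ^ 2
        = (zh.2 0) ^ 2 + (zh.2 1) ^ 2 - (zh.2 2) ^ 2)
    (e6 : z.1 0 * (z.2 1 - z.2 2) + z.2 0 * (z.1 2 - z.1 1)
        = zh.1 0 * (zh.2 1 - zh.2 2) + zh.2 0 * (zh.1 2 - zh.1 1)) :
    ∃ s : ℝ, zh.1 = Rp s z.1 ∧ zh.2 = Rp s z.2 := by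
  obtain ⟨x, y⟩ := z
  obtain ⟨u, v⟩ := zh
  obtain ⟨hx, -, hxy⟩ := hz
  obtain ⟨hu, -, huv⟩ := hzh
  simp only [Lprod] at *
  have ha : x 1 - x 2 ≠ 0 := fun h => by
    rw [sub_eq_zero.mp h] at hx
    nlinarith [sq_nonneg (x 0)]
  obtain ⟨s, hs⟩ : ∃ s : ℝ, s * (x 1 - x 2) = x 0 - u 0 :=
    ⟨(x 0 - u 0) / (x 1 - x 2), div_mul_cancel₀ _ ha⟩
  have hu0 : u 0 = x 0 - s * (x 1 - x 2) := by linarith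
  have hu1 : u 1 = u 2 + (x 1 - x 2) := by linarith
  have hv1 : v 1 = v 2 + (y 1 - y 2) := by linarith
  have hu2 : u 2 = s * x 0 - s ^ 2 / 2 * x 1 + (1 + s ^ 2 / 2) * x 2 := by
    apply mul_left_cancel₀ ha
    rw [hu0, hu1] at hu
    linear_combination (hu - hx) / 2
  have hv0 : v 0 = y 0 - s * (y 1 - y 2) := by
    apply mul_left_cancel₀ ha
    rw [hu0, hu1, hv1] at e6
    linear_combination e6
  have hv2 : v 2 = s * y 0 - s ^ 2 / 2 * y 1 + (1 + s ^ 2 / 2) * y 2 := by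
    apply mul_left_cancel₀ ha
    rw [hu0, hu1, hv0, hv1, hu2] at huv
    linear_combination huv - hxy
  refine ⟨s, ?_, ?_⟩ <;> ext i <;> fin_cases i <;> simp [Rp] <;> linarith
end
end
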